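/- arXiv:1904.13330 — 5 statements merged into one kernel-verified Lean document; each statement's English description precedes it below -/
import Mathlib

section
/- Let (X_i)_{i≥1} be i.i.d. random variables with P(X_i = +1) = q and P(X_i = −1) = p = 1 − q, 0 < q < 1, and let S_n = X_1 + ⋯ + X_n. Let ν = inf{n ≥ 1 : S_n = −1} be the first hitting time of −1. Then for every integer m ≥ 0, P[ν = 2m + 1] = p (pq)^m C_m, where C_m is the m-th Catalan number. -/
open MeasureTheory ProbabilityTheory Filter Finset

/-- Partial sums of the walk: `walkS X n ω = X 1 ω + ⋯ + X n ω`. -/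
noncomputable def walkS {Ω : Type*} (X : ℕ → Ω → ℤ) (n : ℕ) (ω : Ω) : ℤ :=
  ∑ i ∈ Finset.Icc 1 n, X i ω

/-- First hitting time of `-1` by the walk (`sInf ∅ = 0` by convention). -/
noncomputable def hitMinusOne {Ω : Type*} (X : ℕ → Ω → ℤ) (ω : Ω) : ℕ :=
  sInf {n : ℕ | 1 ≤ n ∧ walkS X n ω = -1}

/-- The walk avoids `-1` at times `1..n` and is at `h` at time `n`. -/
def avoidSet {Ω : Type*} (X : ℕ → Ω → ℤ) (n : ℕ) (h : ℤ) : Set Ω :=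
  {ω | (∀ i, 1 ≤ i → i ≤ n → walkS X i ω ≠ -1) ∧ walkS X n ω = h}

lemma walkS_succ {Ω : Type*} (X : ℕ → Ω → ℤ) (n : ℕ) (ω : Ω) :
    walkS X (n + 1) ω = walkS X n ω + X (n + 1) ω := by
  unfold walkS
  rw [Finset.sum_Icc_succ_top (by omega)]

lemma walkS_measurable {Ω : Type*} [MeasurableSpace Ω] (X : ℕ → Ω → ℤ)
    (hmeas : ∀ i, Measurable (X i)) (n : ℕ) : Measurable (walkS X n) := by
  unfold walkS
  exact Finset.measurable_sum _ (fun i _ => hmeas i)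

lemma avoidSet_measurable {Ω : Type*} [MeasurableSpace Ω] (X : ℕ → Ω → ℤ)
    (hmeas : ∀ i, Measurable (X i)) (n : ℕ) (h : ℤ) : MeasurableSet (avoidSet X n h) := by
  have : avoidSet X n h = (⋂ i, ⋂ (_ : 1 ≤ i), ⋂ (_ : i ≤ n), (walkS X i ⁻¹' {-1})ᶜ) ∩
      walkS X n ⁻¹' {h} := by
    ext ω; simp [avoidSet]
  rw [this]
  refine MeasurableSet.inter ?_ (walkS_measurable X hmeas n (measurableSet_singleton _))
  exact MeasurableSet.iInter fun i => MeasurableSet.iInter fun _ => MeasurableSet.iInter fun _ =>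
    (walkS_measurable X hmeas i (measurableSet_singleton _)).compl

lemma avoidSet_indep {Ω : Type*} [MeasurableSpace Ω] {μ : Measure Ω} [IsProbabilityMeasure μ]
    (X : ℕ → Ω → ℤ) (hmeas : ∀ i, Measurable (X i)) (hindep : iIndepFun X μ)
    (n : ℕ) (h x : ℤ) :
    μ.real (avoidSet X n h ∩ {ω | X (n + 1) ω = x})
      = μ.real (avoidSet X n h) * μ.real {ω | X (n + 1) ω = x} := by
  have hI := hindep.indepFun_finset (Finset.Icc 1 n) {n + 1}
    (by simp) hmeas
  let g : (Finset.Icc 1 n → ℤ) → ℕ → ℤ := fun f i =>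
    ∑ j ∈ Finset.Icc 1 i, if hj : j ∈ Finset.Icc 1 n then f ⟨j, hj⟩ else 0
  have hg : ∀ ω i, i ≤ n → g (fun j => X j ω) i = walkS X i ω := by
    intro ω i hi
    unfold walkS
    refine Finset.sum_congr rfl fun j hj => ?_
    rw [Finset.mem_Icc] at hj
    rw [dif_pos (Finset.mem_Icc.2 ⟨hj.1, hj.2.trans hi⟩)]
  have h1 : avoidSet X n h = (fun ω (j : Finset.Icc 1 n) => X j ω) ⁻¹'
      {f | (∀ i, 1 ≤ i → i ≤ n → g f i ≠ -1) ∧ g f n = h} := by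
    ext ω
    simp only [avoidSet, Set.mem_setOf_eq, Set.mem_preimage]
    rw [hg ω n le_rfl]
    refine and_congr_left fun _ => forall_congr' fun i => forall_congr' fun _ =>
      forall_congr' fun hi => ?_
    rw [hg ω i hi]
  have h2 : {ω | X (n + 1) ω = x} = (fun ω (j : ({n + 1} : Finset ℕ)) => X j ω) ⁻¹'
      {f | f ⟨n + 1, by simp⟩ = x} := by
    ext ω; simp
  have := hI.measure_inter_preimage_eq_mul _ _
    (Set.to_countable {f | (∀ i, 1 ≤ i → i ≤ n → g f i ≠ -1) ∧ g f n = h}).measurableSet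
    (Set.to_countable {f : ({n + 1} : Finset ℕ) → ℤ | f ⟨n + 1, by simp⟩ = x}).measurableSet
  rw [← h1, ← h2] at this
  simp only [Measure.real, this, ENNReal.toReal_mul]

lemma steps_ae {Ω : Type*} [MeasurableSpace Ω] {μ : Measure Ω} [IsProbabilityMeasure μ]
    (q p : ℝ) (hpq : p + q = 1) (X : ℕ → Ω → ℤ) (hmeas : ∀ i, Measurable (X i))
    (hup : ∀ i, μ.real {ω | X i ω = 1} = q)
    (hdown : ∀ i, μ.real {ω | X i ω = -1} = p) (n : ℕ) :
    ∀ᵐ ω ∂μ, X n ω = 1 ∨ X n ω = -1 := by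
  have hm : ∀ x, MeasurableSet {ω | X n ω = x} := fun x => hmeas n (measurableSet_singleton x)
  have hd : Disjoint {ω | X n ω = 1} {ω | X n ω = -1} := by
    rw [Set.disjoint_left]; intro ω h1 h2
    simp only [Set.mem_setOf_eq] at h1 h2; omega
  have h := measureReal_union (μ := μ) hd (hm (-1))
  rw [hup, hdown] at h
  have h1 := probReal_compl_eq_one_sub (μ := μ) ((hm 1).union (hm (-1)))
  rw [h, show 1 - (q + p) = 0 by linarith, measureReal_eq_zero_iff] at h1
  rw [ae_iff]
  exact h1

lemma avoidSet_step {Ω : Type*} [MeasurableSpace Ω] {μ : Measure Ω} [IsProbabilityMeasure μ]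
    (q p : ℝ) (hpq : p + q = 1) (X : ℕ → Ω → ℤ) (hmeas : ∀ i, Measurable (X i))
    (hindep : iIndepFun X μ)
    (hup : ∀ i, μ.real {ω | X i ω = 1} = q)
    (hdown : ∀ i, μ.real {ω | X i ω = -1} = p) (n : ℕ) (h : ℤ) (hh : h ≠ -1) :
    μ.real (avoidSet X (n + 1) h)
      = μ.real (avoidSet X n (h - 1)) * q + μ.real (avoidSet X n (h + 1)) * p := by
  have hm : ∀ x, MeasurableSet {ω | X (n + 1) ω = x} :=
    fun x => hmeas _ (measurableSet_singleton x)
  have hd : Disjoint (avoidSet X n (h - 1) ∩ {ω | X (n + 1) ω = 1})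
      (avoidSet X n (h + 1) ∩ {ω | X (n + 1) ω = -1}) := by
    rw [Set.disjoint_left]; rintro ω ⟨_, h1⟩ ⟨_, h2⟩
    simp only [Set.mem_setOf_eq] at h1 h2; omega
  rw [← hup (n + 1), ← hdown (n + 1), ← avoidSet_indep X hmeas hindep,
    ← avoidSet_indep X hmeas hindep,
    ← measureReal_union hd ((avoidSet_measurable X hmeas _ _).inter (hm _))]
  refine measureReal_congr ?_
  filter_upwards [steps_ae q p hpq X hmeas hup hdown (n + 1)] with ω hω
  refine propext ?_
  change ω ∈ avoidSet X (n + 1) h ↔ ω ∈ (avoidSet X n (h - 1) ∩ {ω | X (n + 1) ω = 1}) ∪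
      (avoidSet X n (h + 1) ∩ {ω | X (n + 1) ω = -1})
  have hs := walkS_succ X n ω
  simp only [avoidSet, Set.mem_setOf_eq, Set.mem_union, Set.mem_inter_iff]
  constructor
  · rintro ⟨h1, h2⟩
    have h3 : ∀ i, 1 ≤ i → i ≤ n → walkS X i ω ≠ -1 := fun i a b => h1 i a (by omega)
    rcases hω with hx | hx
    · exact Or.inl ⟨⟨h3, by omega⟩, hx⟩
    · exact Or.inr ⟨⟨h3, by omega⟩, hx⟩
  · have key : ∀ (_ : ∀ i, 1 ≤ i → i ≤ n → walkS X i ω ≠ -1) (_ : walkS X (n + 1) ω = h),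
        (∀ i, 1 ≤ i → i ≤ n + 1 → walkS X i ω ≠ -1) ∧ walkS X (n + 1) ω = h := by
      intro h1 h2
      refine ⟨fun i a b => ?_, h2⟩
      rcases Nat.lt_or_ge n i with hi | hi
      · obtain rfl : i = n + 1 := by omega
        omega
      · exact h1 i a hi
    rintro (⟨⟨h1, h2⟩, h3⟩ | ⟨⟨h1, h2⟩, h3⟩)
    · exact key h1 (by omega)
    · exact key h1 (by omega)

lemma avoidSet_neg_one {Ω : Type*} (X : ℕ → Ω → ℤ) (n : ℕ) : avoidSet X n (-1) = ∅ := by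
  ext ω
  simp only [avoidSet, Set.mem_setOf_eq, Set.mem_empty_iff_false, iff_false, not_and]
  intro h1 h2
  rcases Nat.eq_zero_or_pos n with rfl | hn
  · simp [walkS] at h2
  · exact h1 n hn le_rfl h2

lemma avoidSet_zero {Ω : Type*} (X : ℕ → Ω → ℤ) (h : ℤ) (hh : h ≠ 0) : avoidSet X 0 h = ∅ := by
  ext ω
  simp [avoidSet, walkS, hh.symm]

lemma avoidSet_null {Ω : Type*} [MeasurableSpace Ω] {μ : Measure Ω} [IsProbabilityMeasure μ]
    (q p : ℝ) (hpq : p + q = 1) (X : ℕ → Ω → ℤ) (hmeas : ∀ i, Measurable (X i))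
    (hindep : iIndepFun X μ)
    (hup : ∀ i, μ.real {ω | X i ω = 1} = q)
    (hdown : ∀ i, μ.real {ω | X i ω = -1} = p) (n : ℕ) :
    ∀ h : ℤ, (h < 0 ∨ (n : ℤ) < h) → μ.real (avoidSet X n h) = 0 := by
  induction n with
  | zero => intro h hh; rw [avoidSet_zero X h (by push_cast at hh; omega)]; simp
  | succ n ih =>
    intro h hh
    by_cases h1 : h = -1
    · rw [h1, avoidSet_neg_one]; simp
    · rw [avoidSet_step q p hpq X hmeas hindep hup hdown n h h1, ih (h - 1) (by push_cast at hh; omega),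
        ih (h + 1) (by push_cast at hh; omega)]
      simp

lemma avoidSet_prob {Ω : Type*} [MeasurableSpace Ω] {μ : Measure Ω} [IsProbabilityMeasure μ]
    (q p : ℝ) (hpq : p + q = 1) (X : ℕ → Ω → ℤ) (hmeas : ∀ i, Measurable (X i))
    (hindep : iIndepFun X μ)
    (hup : ∀ i, μ.real {ω | X i ω = 1} = q)
    (hdown : ∀ i, μ.real {ω | X i ω = -1} = p) (n : ℕ) :
    ∀ u d : ℕ, u + d = n → d ≤ u + 1 → μ.real (avoidSet X n ((u : ℤ) - d))
      = q ^ u * p ^ d * (((u : ℝ) + 1 - d) / (u + 1) * (Nat.choose (u + d) d)) := by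
  induction n with
  | zero =>
    intro u d h1 _
    obtain rfl : u = 0 := by omega
    obtain rfl : d = 0 := by omega
    have : avoidSet X 0 0 = Set.univ := by ext ω; simp [avoidSet, walkS]; intros; omega
    simp [this]
  | succ n ih =>
    intro u d h1 h2
    rcases Nat.lt_or_ge u d with hlt | hge
    · obtain rfl : d = u + 1 := by omega
      have : (u : ℤ) - ((u + 1 : ℕ) : ℤ) = -1 := by push_cast; ring
      rw [this, avoidSet_neg_one]
      simp
    obtain ⟨u, rfl⟩ : ∃ v, u = v + 1 := ⟨u - 1, by omega⟩
    rw [avoidSet_step q p hpq X hmeas hindep hup hdown n _ (by omega)]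
    have e1 : ((u + 1 : ℕ) : ℤ) - d - 1 = (u : ℤ) - d := by push_cast; ring
    rw [e1, ih u d (by omega) hge]
    rcases d with _ | d
    · rw [avoidSet_null q p hpq X hmeas hindep hup hdown n _ (by right; push_cast; omega)]
      have : (u : ℝ) + 1 ≠ 0 := by positivity
      have : (u : ℝ) + 1 + 1 ≠ 0 := by positivity
      simp
      field_simp
      ring
    · have e2 : ((u + 1 : ℕ) : ℤ) - ((d + 1 : ℕ) : ℤ) + 1 = ((u + 1 : ℕ) : ℤ) - (d : ℕ) := by
        push_cast; ring
      rw [e2, ih (u + 1) d (by omega) (by omega)]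
      have c1 : u + 1 + (d + 1) = (u + d + 1) + 1 := by ring
      have c2 : u + (d + 1) = u + d + 1 := by ring
      have c3 : u + 1 + d = u + d + 1 := by ring
      rw [c1, c2, c3, Nat.choose_succ_succ' (u + d + 1) d]
      have hc := Nat.choose_succ_right_eq (u + d + 1) d
      rw [show u + d + 1 - d = u + 1 by omega] at hc
      have hc' : ((u + d + 1).choose (d + 1) : ℝ) * (d + 1) = (u + d + 1).choose d * (u + 1) := by
        exact_mod_cast hc
      have hd : (d : ℝ) + 1 ≠ 0 := by positivity
      have h3 : (u : ℝ) + 1 ≠ 0 := by positivity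
      have h4 : (u : ℝ) + 1 + 1 ≠ 0 := by positivity
      have hy : ((u + d + 1).choose (d + 1) : ℝ) = (u + d + 1).choose d * (u + 1) / (d + 1) := by
        field_simp; linarith
      push_cast
      rw [hy]
      field_simp
      ring

theorem stmt0 {Ω : Type*} [MeasureSpace Ω] [IsProbabilityMeasure (ℙ : Measure Ω)]
    (q p : ℝ) (hq : 0 < q) (hq1 : q < 1) (hp : p = 1 - q)
    (X : ℕ → Ω → ℤ) (hmeas : ∀ i, Measurable (X i))
    (hindep : iIndepFun X ℙ)
    (hup : ∀ i, ℙ {ω | X i ω = 1} = ENNReal.ofReal q)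
    (hdown : ∀ i, ℙ {ω | X i ω = -1} = ENNReal.ofReal p)
    (m : ℕ) :
    ℙ {ω | hitMinusOne X ω = 2 * m + 1}
      = ENNReal.ofReal (p * (p * q) ^ m * catalan m) := by
  have hpq : p + q = 1 := by linarith
  have hup' : ∀ i, (ℙ : Measure Ω).real {ω | X i ω = 1} = q := fun i => by
    rw [Measure.real, hup, ENNReal.toReal_ofReal hq.le]
  have hdown' : ∀ i, (ℙ : Measure Ω).real {ω | X i ω = -1} = p := fun i => by
    rw [Measure.real, hdown, ENNReal.toReal_ofReal (by linarith)]
  have hnull := avoidSet_null q p hpq X hmeas hindep hup' hdown' (2 * m) (-2) (by omega)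
  rw [measureReal_eq_zero_iff] at hnull
  have hset : ({ω | hitMinusOne X ω = 2 * m + 1} : Set Ω) =ᵐ[ℙ]
      (avoidSet X (2 * m) 0 ∩ {ω | X (2 * m + 1) ω = -1} : Set Ω) := by
    filter_upwards [steps_ae q p hpq X hmeas hup' hdown' (2 * m + 1),
      measure_eq_zero_iff_ae_notMem.1 hnull] with ω hω hω2
    refine propext ?_
    change hitMinusOne X ω = 2 * m + 1 ↔
      ω ∈ avoidSet X (2 * m) 0 ∩ {ω | X (2 * m + 1) ω = -1}
    have hs := walkS_succ X (2 * m) ω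
    simp only [avoidSet, Set.mem_setOf_eq, Set.mem_inter_iff] at hω2 ⊢
    constructor
    · intro h
      have hne : {n : ℕ | 1 ≤ n ∧ walkS X n ω = -1}.Nonempty := by
        by_contra hcon
        rw [Set.not_nonempty_iff_eq_empty] at hcon
        simp [hitMinusOne, hcon] at h
      have hmem := Nat.sInf_mem hne
      change sInf _ = _ at h
      rw [h] at hmem
      have hav : ∀ i, 1 ≤ i → i ≤ 2 * m → walkS X i ω ≠ -1 := by
        intro i hi hi2 hi3
        have := Nat.sInf_le (s := {n : ℕ | 1 ≤ n ∧ walkS X n ω = -1}) ⟨hi, hi3⟩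
        omega
      have hend := hmem.2
      rcases hω with hx | hx
      · exact absurd ⟨hav, by omega⟩ hω2
      · exact ⟨⟨hav, by omega⟩, hx⟩
    · rintro ⟨⟨hav, h0⟩, hx⟩
      have hmem : 2 * m + 1 ∈ {n : ℕ | 1 ≤ n ∧ walkS X n ω = -1} := ⟨by omega, by omega⟩
      refine le_antisymm (Nat.sInf_le hmem) ?_
      refine le_csInf ⟨_, hmem⟩ ?_
      rintro i ⟨hi, hi2⟩
      by_contra hlt
      exact hav i hi (by omega) hi2
  rw [measure_congr hset, ← ofReal_measureReal (by finiteness),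
    avoidSet_indep X hmeas hindep, hdown']
  congr 1
  have h := avoidSet_prob q p hpq X hmeas hindep hup' hdown' (2 * m) m m (by ring) (by omega)
  rw [sub_self] at h
  rw [h]
  have hcat : ((m : ℝ) + 1) * catalan m = (m + m).choose m := by
    have := succ_mul_catalan_eq_centralBinom m
    rw [Nat.centralBinom_eq_two_mul_choose, two_mul] at this
    exact_mod_cast this
  rw [← hcat]
  have : (m : ℝ) + 1 ≠ 0 := by positivity
  rw [mul_pow]
  field_simp
  ring
end

section
/- Let L be the number of official new blocks added to the official blockchain after an attack cycle. Then P[L = 1] = p, P[L = 2] = pq + pq², and for every n ≥ 3, P[L = n] = pq² (pq)^{n−2} C_{n−2}, where C_{n−2} is the (n−2)-th Catalan number. -/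
open MeasureTheory ProbabilityTheory Filter Finset

/-- The stopping time `τ = inf {n ≥ 3 : S_n = 1}` (`sInf ∅ = 0` by convention). -/
noncomputable def cycleTau {Ω : Type*} (X : ℕ → Ω → ℤ) (ω : Ω) : ℕ :=
  sInf {n : ℕ | 3 ≤ n ∧ walkS X n ω = 1}

/-- The number `L` of official blocks added by an attack cycle. -/
noncomputable def cycleL {Ω : Type*} (X : ℕ → Ω → ℤ) (ω : Ω) : ℕ :=
  if X 1 ω = -1 then 1 else if X 2 ω = -1 then 2 else (cycleTau X ω + 1) / 2

/-- First passage event: walk started from height `h` after step `i` first hits `0` after `t` more steps. -/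
def fpE {Ω : Type*} (X : ℕ → Ω → ℤ) : ℕ → ℕ → ℕ → Set Ω
  | 0, 0, _ => Set.univ
  | 0, _ + 1, _ => ∅
  | t + 1, h, i => match h with
    | 0 => ∅
    | h + 1 => ({ω | X (i + 1) ω = 1} ∩ fpE X t (h + 2) (i + 1)) ∪
      ({ω | X (i + 1) ω = -1} ∩ fpE X t h (i + 1))

/-- First passage probabilities. -/
noncomputable def fpA (q p : ℝ) : ℕ → ℕ → ℝ
  | 0, 0 => 1
  | 0, _ + 1 => 0
  | _ + 1, 0 => 0
  | t + 1, h + 1 => q * fpA q p t (h + 2) + p * fpA q p t h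

/-- Ballot numbers. -/
noncomputable def fpB : ℕ → ℕ → ℝ
  | 0, 0 => 1
  | 0, _ + 1 => 0
  | h + 1, k => (h + 1) * (2 * k + h).factorial / (k.factorial * (k + h + 1).factorial)

lemma fpB_succ (h k : ℕ) : fpB (h + 1) (k + 1) = fpB (h + 2) k + fpB h (k + 1) := by
  have fs : ∀ n : ℕ, ((n + 1).factorial : ℝ) = (n + 1) * n.factorial := by
    intro n; rw [Nat.factorial_succ]; push_cast; ring
  have h0 : ∀ n : ℕ, (n.factorial : ℝ) ≠ 0 := fun n => by positivity
  cases h with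
  | zero =>
    simp only [fpB]
    rw [show 2 * (k + 1) + 0 = (2 * k + 1) + 1 by ring, show k + 1 + 0 + 1 = k + 1 + 1 by ring,
      show 2 * k + (0 + 1) = 2 * k + 1 by ring, show k + (0 + 1) + 1 = k + 1 + 1 by ring]
    rw [fs (2 * k + 1), fs (k + 1), fs k]
    have := h0 k
    have := h0 (2 * k + 1)
    push_cast
    field_simp
    ring
  | succ h =>
    simp only [fpB]
    rw [show 2 * (k + 1) + (h + 1) = (2 * k + h + 2) + 1 by ring,
      show k + 1 + (h + 1) + 1 = k + h + 2 + 1 by ring,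
      show 2 * k + (h + 1 + 1) = 2 * k + h + 2 by ring,
      show k + (h + 1 + 1) + 1 = k + h + 2 + 1 by ring,
      show 2 * (k + 1) + h = 2 * k + h + 2 by ring,
      show k + 1 + h + 1 = k + h + 2 by ring]
    rw [fs (2 * k + h + 2), fs (k + h + 2), fs k]
    have := h0 k
    have := h0 (2 * k + h + 2)
    have := h0 (k + h + 2)
    push_cast
    field_simp
    ring

lemma fpB_one (k : ℕ) : fpB 1 k = catalan k := by
  have h1 : ((k + 1) * catalan k : ℝ) = k.centralBinom := by
    exact_mod_cast succ_mul_catalan_eq_centralBinom k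
  have h2 : ((2 * k).factorial : ℝ) = k.centralBinom * (k.factorial * k.factorial) := by
    have := Nat.choose_mul_factorial_mul_factorial (show k ≤ 2 * k by omega)
    rw [show 2 * k - k = k by omega] at this
    rw [Nat.centralBinom, ← this]; push_cast; ring
  simp only [fpB]
  have h0 : (k.factorial : ℝ) ≠ 0 := by positivity
  rw [add_zero, add_zero, h2, ← h1, Nat.factorial_succ]
  push_cast
  field_simp
  ring

lemma fpA_big (q p : ℝ) (t h : ℕ) (hh : t < h) : fpA q p t h = 0 := by
  induction t generalizing h with
  | zero => obtain ⟨h, rfl⟩ : ∃ k, h = k + 1 := ⟨h - 1, by omega⟩; simp [fpA]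
  | succ t ih =>
    obtain ⟨h, rfl⟩ : ∃ k, h = k + 1 := ⟨h - 1, by omega⟩
    simp [fpA, ih (h + 2) (by omega), ih h (by omega)]

lemma fpA_eq (q p : ℝ) (t h k : ℕ) (hh : t = 2 * k + h) :
    fpA q p t h = q ^ k * p ^ (k + h) * fpB h k := by
  induction t generalizing h k with
  | zero =>
    obtain ⟨rfl, rfl⟩ : h = 0 ∧ k = 0 := by omega
    simp [fpA, fpB]
  | succ t ih =>
    cases h with
    | zero =>
      obtain ⟨k, rfl⟩ : ∃ j, k = j + 1 := ⟨k - 1, by omega⟩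
      simp [fpA, fpB]
    | succ h =>
      rw [fpA, ih h k (by omega)]
      cases k with
      | zero =>
        rw [fpA_big _ _ _ _ (by omega)]
        cases h with
        | zero => simp [fpB]
        | succ h =>
          have h0 : ∀ n : ℕ, (n.factorial : ℝ) ≠ 0 := fun n => by positivity
          have := h0 h
          simp only [fpB]
          simp [Nat.factorial_succ]
          field_simp
          push_cast
          ring
      | succ k =>
        rw [ih (h + 2) k (by omega), fpB_succ]
        ring

lemma fpA_nonneg {q p : ℝ} (hq : 0 ≤ q) (hp : 0 ≤ p) (t h : ℕ) : 0 ≤ fpA q p t h := by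
  induction t generalizing h with
  | zero => cases h <;> simp [fpA]
  | succ t ih =>
    cases h with
    | zero => simp [fpA]
    | succ h =>
      rw [fpA]
      have := ih (h + 2)
      have := ih h
      positivity

lemma fpE_parity {Ω : Type*} (X : ℕ → Ω → ℤ) (ω : Ω) (t h i : ℕ) (hE : ω ∈ fpE X t h i) :
    t % 2 = h % 2 := by
  induction t generalizing h i with
  | zero => cases h <;> simp [fpE] at hE ⊢
  | succ t ih =>
    cases h with
    | zero => simp [fpE] at hE
    | succ h =>
      rcases hE with hE | hE
      · have := ih _ _ hE.2; omega
      · have := ih _ _ hE.2; omega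

lemma fpE_meas {Ω : Type*} [MeasurableSpace Ω] (X : ℕ → Ω → ℤ) (hX : ∀ i, Measurable (X i))
    (t h i : ℕ) : MeasurableSet (fpE X t h i) := by
  induction t generalizing h i with
  | zero => cases h <;> simp [fpE]
  | succ t ih =>
    cases h with
    | zero => simp [fpE]
    | succ h =>
      exact ((hX _ (measurableSet_singleton (1 : ℤ))).inter (ih _ _)).union
        ((hX _ (measurableSet_singleton (-1 : ℤ))).inter (ih _ _))

lemma fpE_iff {Ω : Type*} (X : ℕ → Ω → ℤ) (ω : Ω) (hω : ∀ i, X i ω = 1 ∨ X i ω = -1)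
    (t h i : ℕ) (hw : walkS X i ω = h + 1) :
    ω ∈ fpE X t h i ↔ walkS X (i + t) ω = 1 ∧ ∀ s < t, walkS X (i + s) ω ≠ 1 := by
  induction t generalizing h i with
  | zero =>
    cases h with
    | zero => simp [fpE, hw]
    | succ h => simp [fpE, hw]; omega
  | succ t ih =>
    cases h with
    | zero =>
      simp only [fpE, Set.mem_empty_iff_false, false_iff, not_and, not_forall]
      intro _
      exact ⟨0, by omega, by simp [hw]⟩
    | succ h =>
      have key : (walkS X (i + (t + 1)) ω = 1 ∧ ∀ s < t + 1, walkS X (i + s) ω ≠ 1) ↔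
          (walkS X (i + 1 + t) ω = 1 ∧ ∀ s < t, walkS X (i + 1 + s) ω ≠ 1) := by
        rw [show i + (t + 1) = i + 1 + t by ring]
        refine and_congr_right fun _ => ⟨fun H s hs => ?_, fun H s hs => ?_⟩
        · have := H (s + 1) (by omega)
          rwa [show i + (s + 1) = i + 1 + s by ring] at this
        · cases s with
          | zero => simp only [add_zero, hw]; push_cast; omega
          | succ s =>
            have := H s (by omega)
            rwa [show i + (s + 1) = i + 1 + s by ring]
      rw [key]
      have hs := walkS_succ X i ω
      rcases hω (i + 1) with h1 | h1
      · rw [← ih (h + 2) (i + 1) (by rw [hs, hw, h1]; push_cast; ring)]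
        simp [fpE, h1]
      · rw [← ih h (i + 1) (by rw [hs, hw, h1]; push_cast; ring)]
        simp [fpE, h1]

lemma cycleTau_eq_iff {Ω : Type*} (X : ℕ → Ω → ℤ) (ω : Ω) (hω : ∀ i, X i ω = 1 ∨ X i ω = -1)
    (h1 : X 1 ω = 1) (h2 : X 2 ω = 1) (m : ℕ) :
    cycleTau X ω = m + 3 ↔ ω ∈ fpE X (m + 1) 1 2 := by
  have hw : walkS X 2 ω = (1 : ℕ) + 1 := by
    rw [walkS_succ, walkS_succ]; simp [walkS, h1, h2]
  rw [fpE_iff X ω hω _ _ _ hw]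
  unfold cycleTau
  constructor
  · intro H
    have hne : {n : ℕ | 3 ≤ n ∧ walkS X n ω = 1}.Nonempty := by
      by_contra hc
      rw [Set.not_nonempty_iff_eq_empty] at hc
      rw [hc] at H
      simp at H
    have hm := Nat.sInf_mem hne
    rw [H] at hm
    refine ⟨by rw [show 2 + (m + 1) = m + 3 by ring]; exact hm.2, fun s hs hc => ?_⟩
    cases s with
    | zero => simp [hw] at hc
    | succ s =>
      have := Nat.sInf_le (s := {n : ℕ | 3 ≤ n ∧ walkS X n ω = 1}) (m := 2 + (s + 1))
        ⟨by omega, hc⟩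
      omega
  · rintro ⟨ha, hb⟩
    apply le_antisymm
    · exact Nat.sInf_le ⟨by omega, by rw [show m + 3 = 2 + (m + 1) by ring]; exact ha⟩
    · refine le_csInf (s := {n : ℕ | 3 ≤ n ∧ walkS X n ω = 1}) ⟨2 + (m + 1), by omega, ha⟩ ?_
      rintro b ⟨hb3, hbw⟩
      by_contra hlt
      refine hb (b - 2) (by omega) ?_
      rwa [show 2 + (b - 2) = b by omega]

lemma cycleTau_ge {Ω : Type*} (X : ℕ → Ω → ℤ) (ω : Ω) : cycleTau X ω = 0 ∨ 3 ≤ cycleTau X ω := by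
  unfold cycleTau
  rcases Set.eq_empty_or_nonempty {n : ℕ | 3 ≤ n ∧ walkS X n ω = 1} with h | h
  · left; rw [h]; simp
  · right; exact (Nat.sInf_mem h).1

/-- Cylinder event. -/
def cyl {Ω : Type*} (X : ℕ → Ω → ℤ) (w : ℕ → ℤ) (i : ℕ) : Set Ω :=
  ⋂ j ∈ Finset.Icc 1 i, X j ⁻¹' {w j}

lemma cyl_succ {Ω : Type*} (X : ℕ → Ω → ℤ) (w : ℕ → ℤ) (i : ℕ) (a : ℤ) :
    cyl X (Function.update w (i + 1) a) (i + 1) = cyl X w i ∩ {ω | X (i + 1) ω = a} := by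
  ext ω
  simp only [cyl, Set.mem_iInter, Finset.mem_Icc, Set.mem_preimage, Set.mem_singleton_iff,
    Set.mem_inter_iff, Set.mem_ofPred_eq]
  constructor
  · intro H
    refine ⟨fun j hj => ?_, ?_⟩
    · have := H j ⟨hj.1, by omega⟩
      rwa [Function.update_of_ne (by omega)] at this
    · simpa using H (i + 1) (by omega)
  · rintro ⟨H, H2⟩ j hj
    by_cases hji : j = i + 1
    · subst hji; simpa using H2
    · rw [Function.update_of_ne hji]; exact H j (by omega)

section
variable {Ω : Type*} [MeasureSpace Ω]

lemma cyl_measure (X : ℕ → Ω → ℤ) (hindep : iIndepFun X ℙ) (w : ℕ → ℤ) (i : ℕ) :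
    ℙ (cyl X w i) = ∏ j ∈ Finset.Icc 1 i, ℙ (X j ⁻¹' {w j}) :=
  hindep.measure_inter_preimage_eq_mul _ (fun j _ => measurableSet_singleton _)

lemma cyl_succ_measure (X : ℕ → Ω → ℤ) (hindep : iIndepFun X ℙ) (w : ℕ → ℤ) (i : ℕ) (a : ℤ) :
    ℙ (cyl X (Function.update w (i + 1) a) (i + 1)) = ℙ (cyl X w i) * ℙ {ω | X (i + 1) ω = a} := by
  rw [cyl_measure X hindep, cyl_measure X hindep, Finset.prod_Icc_succ_top (by omega)]
  congr 1
  · refine Finset.prod_congr rfl fun j hj => ?_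
    rw [Finset.mem_Icc] at hj
    rw [Function.update_of_ne (by omega)]
  · simp [Set.preimage]

lemma cyl_meas (X : ℕ → Ω → ℤ) (hX : ∀ i, Measurable (X i)) (w : ℕ → ℤ) (i : ℕ) :
    MeasurableSet (cyl X w i) :=
  Finset.measurableSet_biInter _ fun j _ => hX j (measurableSet_singleton _)

lemma fp_measure (q p : ℝ) (hq : 0 ≤ q) (hp : 0 ≤ p)
    (X : ℕ → Ω → ℤ) (hmeas : ∀ i, Measurable (X i))
    (hindep : iIndepFun X ℙ)
    (hup : ∀ i, ℙ {ω | X i ω = 1} = ENNReal.ofReal q)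
    (hdown : ∀ i, ℙ {ω | X i ω = -1} = ENNReal.ofReal p) (t h i : ℕ) (w : ℕ → ℤ) :
    ℙ (cyl X w i ∩ fpE X t h i) = ℙ (cyl X w i) * ENNReal.ofReal (fpA q p t h) := by
  induction t generalizing h i w with
  | zero => cases h <;> simp [fpE, fpA]
  | succ t ih =>
    cases h with
    | zero => simp [fpE, fpA]
    | succ h =>
      have e : cyl X w i ∩ fpE X (t + 1) (h + 1) i =
          (cyl X (Function.update w (i + 1) 1) (i + 1) ∩ fpE X t (h + 2) (i + 1)) ∪
          (cyl X (Function.update w (i + 1) (-1)) (i + 1) ∩ fpE X t h (i + 1)) := by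
        rw [cyl_succ, cyl_succ, Set.inter_assoc, Set.inter_assoc, ← Set.inter_union_distrib_left]
        rfl
      rw [e, measure_union, ih, ih, cyl_succ_measure X hindep, cyl_succ_measure X hindep, hup,
        hdown, fpA, ENNReal.ofReal_add, ENNReal.ofReal_mul hq, ENNReal.ofReal_mul hp]
      · ring
      · exact mul_nonneg hq (fpA_nonneg hq hp _ _)
      · exact mul_nonneg hp (fpA_nonneg hq hp _ _)
      · rw [cyl_succ, cyl_succ, Set.disjoint_left]
        rintro ω ⟨⟨_, h1⟩, _⟩ ⟨⟨_, h2⟩, _⟩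
        simp only [Set.mem_ofPred_eq] at h1 h2
        omega
      · exact (cyl_meas X hmeas _ _).inter (fpE_meas X hmeas _ _ _)

end

theorem stmt1 {Ω : Type*} [MeasureSpace Ω] [IsProbabilityMeasure (ℙ : Measure Ω)]
    (q p : ℝ) (hq : 0 < q) (hq1 : q < 1) (hp : p = 1 - q)
    (X : ℕ → Ω → ℤ) (hmeas : ∀ i, Measurable (X i))
    (hindep : iIndepFun X ℙ)
    (hup : ∀ i, ℙ {ω | X i ω = 1} = ENNReal.ofReal q)
    (hdown : ∀ i, ℙ {ω | X i ω = -1} = ENNReal.ofReal p) :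
    ℙ {ω | cycleL X ω = 1} = ENNReal.ofReal p ∧
    ℙ {ω | cycleL X ω = 2} = ENNReal.ofReal (p * q + p * q ^ 2) ∧
    ∀ n : ℕ, 3 ≤ n →
      ℙ {ω | cycleL X ω = n}
        = ENNReal.ofReal (p * q ^ 2 * (p * q) ^ (n - 2) * catalan (n - 2)) := by
  have hp0 : 0 < p := by linarith
  have hae : ∀ᵐ ω ∂(ℙ : Measure Ω), ∀ i, X i ω = 1 ∨ X i ω = -1 := by
    rw [ae_all_iff]
    intro i
    have hm : MeasurableSet {ω | X i ω = -1} := hmeas i (measurableSet_singleton (-1 : ℤ))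
    have hm1 : MeasurableSet {ω | X i ω = 1} := hmeas i (measurableSet_singleton (1 : ℤ))
    have hu : ℙ ({ω | X i ω = 1} ∪ {ω | X i ω = -1}) = 1 := by
      rw [measure_union _ hm, hup, hdown, ← ENNReal.ofReal_add hq.le hp0.le, hp]
      · simp
      · rw [Set.disjoint_left]
        intro ω h1 h2
        simp only [Set.mem_ofPred_eq] at h1 h2
        omega
    exact (mem_ae_iff_prob_eq_one (hm1.union hm)).2 hu
  have hcyl : ∀ a b : ℤ, cyl X (Function.update (Function.update (fun _ => 0) 1 a) 2 b) 2 =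
      {ω | X 1 ω = a} ∩ {ω | X 2 ω = b} := by
    intro a b
    rw [show (2 : ℕ) = 1 + 1 from rfl, cyl_succ, show Function.update (fun _ => (0 : ℤ)) 1 a =
      Function.update (fun _ => (0 : ℤ)) (0 + 1) a from rfl, cyl_succ X _ 0 a]
    simp [cyl]
  have hcylm : ∀ a b : ℤ, ℙ ({ω | X 1 ω = a} ∩ {ω | X 2 ω = b}) =
      ℙ {ω | X 1 ω = a} * ℙ {ω | X 2 ω = b} := by
    intro a b
    rw [← hcyl, cyl_measure X hindep]
    rw [show Finset.Icc 1 2 = {1, 2} from rfl, Finset.prod_pair (by norm_num)]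
    simp [Set.preimage]
  -- main computation
  have hmain : ∀ k : ℕ, ℙ ({ω | X 1 ω = 1} ∩ {ω | X 2 ω = 1} ∩ fpE X (2 * k + 1) 1 2) =
      ENNReal.ofReal (p * q ^ 2 * (p * q) ^ k * catalan k) := by
    intro k
    rw [← hcyl, fp_measure q p hq.le hp0.le X hmeas hindep hup hdown, hcyl, hcylm, hup, hup,
      fpA_eq q p _ 1 k rfl, fpB_one, ← ENNReal.ofReal_mul hq.le, ← ENNReal.ofReal_mul (by positivity)]
    congr 1
    ring
  have hpt : ∀ ω, (∀ i, X i ω = 1 ∨ X i ω = -1) → X 1 ω = 1 → X 2 ω = 1 → ∀ k : ℕ,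
      ((cycleTau X ω + 1) / 2 = k + 2 ↔ ω ∈ fpE X (2 * k + 1) 1 2) := by
    intro ω hω h1 h2 k
    rw [← cycleTau_eq_iff X ω hω h1 h2 (2 * k)]
    have hodd : cycleTau X ω ≠ 2 * k + 1 + 3 := by
      intro hc
      rw [cycleTau_eq_iff X ω hω h1 h2 (2 * k + 1)] at hc
      have := fpE_parity X ω _ _ _ hc
      omega
    omega
  refine ⟨?_, ?_, ?_⟩
  · rw [← hdown 1]
    congr 1
    ext ω
    simp only [Set.mem_ofPred_eq, cycleL]
    have := cycleTau_ge X ω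
    split_ifs with h1 h2
    · simp [h1]
    · simp [h1]
    · simp only [h1, iff_false]; omega
  · have e : {ω | cycleL X ω = 2} =ᵐ[ℙ] (({ω | X 1 ω = 1} ∩ {ω | X 2 ω = -1}) ∪
        ({ω | X 1 ω = 1} ∩ {ω | X 2 ω = 1} ∩ fpE X (2 * 0 + 1) 1 2) : Set Ω) := by
      filter_upwards [hae] with ω hω
      apply propext
      change cycleL X ω = 2 ↔ (X 1 ω = 1 ∧ X 2 ω = -1) ∨ ((X 1 ω = 1 ∧ X 2 ω = 1) ∧ ω ∈ _)
      unfold cycleL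
      rcases hω 1 with h1 | h1
      · rcases hω 2 with h2 | h2
        · have := hpt ω hω h1 h2 0
          simpa [h1, h2] using this
        · simp [h1, h2]
      · simp [h1]
    rw [measure_congr e, measure_union, hmain, hcylm, hup, hdown, ← ENNReal.ofReal_mul hq.le,
      ← ENNReal.ofReal_add (by positivity) (by positivity)]
    · congr 1
      simp
      ring
    · rw [Set.disjoint_left]
      rintro ω ⟨_, h1⟩ ⟨⟨_, h2⟩, _⟩
      simp only [Set.mem_ofPred_eq] at h1 h2
      omega
    · exact ((hmeas 1 (measurableSet_singleton (1 : ℤ))).inter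
        (hmeas 2 (measurableSet_singleton (1 : ℤ)))).inter (fpE_meas X hmeas _ _ _)
  · intro n hn
    obtain ⟨k, rfl⟩ : ∃ k, n = k + 2 := ⟨n - 2, by omega⟩
    rw [show k + 2 - 2 = k by omega, ← hmain k]
    apply measure_congr
    filter_upwards [hae] with ω hω
    apply propext
    change cycleL X ω = k + 2 ↔ ((X 1 ω = 1 ∧ X 2 ω = 1) ∧ ω ∈ _)
    unfold cycleL
    rcases hω 1 with h1 | h1
    · rcases hω 2 with h2 | h2
      · have := hpt ω hω h1 h2 k
        simpa [h1, h2] using this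
      · simp [h1, h2]; omega
    · simp [h1]
end

section
/- Assume 0 < q < 1/2 and p = 1 − q. For a nonempty Dyck word w let f(w) be the position (index, starting from 1) of the first letter H in w. For every n ≥ 0, the sum of the weights p (pq)^{|w|} over all Dyck words w with f(w) ≤ min(|w|, n) equals (1 − q^n) − p (1 − (pq)^n)/(1 − pq). -/
/-- A Dyck word: every prefix has at least as many `S` (`true`) as `H` (`false`),
and the total numbers of `S` and `H` coincide. -/
def IsDyck (w : List Bool) : Prop :=
  w.count true = w.count false ∧
  ∀ n : ℕ, (w.take n).count false ≤ (w.take n).count true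

/-- `firstH w` is the position (starting from 1) of the first letter `H` in `w`. -/
def firstH (w : List Bool) : ℕ :=
  w.idxOf false + 1

/-- Weight of a path `w` from height `h` to `0` staying nonnegative (zero for other words). -/
def wt (q p : ℝ) : List Bool → ℕ → ℝ
  | [], 0 => p
  | [], _ + 1 => 0
  | true :: w, h => q * wt q p w (h + 1)
  | false :: _, 0 => 0
  | false :: w, h + 1 => p * wt q p w h

theorem hasSum_list {f : List Bool → ℝ} {a b : ℝ}
    (ha : HasSum (fun w => f (true :: w)) a) (hb : HasSum (fun w => f (false :: w)) b) :
    HasSum f (f [] + a + b) := by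
  have e1 : Function.Injective (fun w : List Bool => true :: w) := fun x y h => by simpa using h
  have e2 : Function.Injective (fun w : List Bool => false :: w) := fun x y h => by simpa using h
  have h1 := (hasSum_extend_zero e1).2 ha
  have h2 := (hasSum_extend_zero e2).2 hb
  have h0 : HasSum (fun w : List Bool => if w = [] then f [] else 0) (f []) :=
    hasSum_ite_eq [] (f [])
  refine ((h0.add h1).add h2).congr_fun ?_
  intro w
  have n1 : ∀ w' : List Bool, (∀ v, true :: v ≠ w') →
      Function.extend (fun w : List Bool => true :: w) (fun w => f (true :: w)) 0 w' = 0 := by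
    intro w' h
    rw [Function.extend_apply']
    · rfl
    · rintro ⟨v, hv⟩; exact h v hv
  have n2 : ∀ w' : List Bool, (∀ v, false :: v ≠ w') →
      Function.extend (fun w : List Bool => false :: w) (fun w => f (false :: w)) 0 w' = 0 := by
    intro w' h
    rw [Function.extend_apply']
    · rfl
    · rintro ⟨v, hv⟩; exact h v hv
  match w with
  | [] => rw [n1 _ (by simp), n2 _ (by simp)]; simp
  | true :: w =>
    rw [n2 _ (by simp), e1.extend_apply (fun w => f (true :: w)) 0 w]; simp
  | false :: w =>
    rw [n1 _ (by simp), e2.extend_apply (fun w => f (false :: w)) 0 w]; simp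

theorem hasSum_list_eq {f : List Bool → ℝ} {a b c : ℝ}
    (ha : HasSum (fun w => f (true :: w)) a) (hb : HasSum (fun w => f (false :: w)) b)
    (hc : c = f [] + a + b) : HasSum f c := hc ▸ hasSum_list ha hb

theorem wt_nonneg {q p : ℝ} (hq : 0 ≤ q) (hp : 0 ≤ p) (w : List Bool) (h : ℕ) :
    0 ≤ wt q p w h := by
  induction w generalizing h with
  | nil => cases h <;> simp [wt, hp]
  | cons b w ih =>
    cases b
    · cases h
      · simp [wt]
      · simp only [wt]; exact mul_nonneg hp (ih _)
    · simp only [wt]; exact mul_nonneg hq (ih _)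

theorem wt_trunc {q p : ℝ} (hq : 0 ≤ q) (hp : 0 ≤ p) (hpq : q + p = 1) (N : ℕ) :
    ∀ h : ℕ, ∃ a ≤ (1 : ℝ), HasSum (fun w => if w.length < N then wt q p w h else 0) a := by
  induction N with
  | zero => intro h; exact ⟨0, by norm_num, by simp⟩
  | succ N ih =>
    intro h
    obtain ⟨a, ha, hA⟩ := ih (h + 1)
    have hA' : HasSum (fun w : List Bool =>
        if (true :: w).length < N + 1 then wt q p (true :: w) h else 0) (q * a) := by
      refine (hA.mul_left q).congr_fun fun w => ?_
      simp [wt]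
    cases h with
    | zero =>
      have hB : HasSum (fun w : List Bool =>
        if (false :: w).length < N + 1 then wt q p (false :: w) 0 else 0) 0 := by
        simp [wt]
      refine ⟨_, ?_, hasSum_list hA' hB⟩
      simp [wt]; nlinarith
    | succ h =>
      obtain ⟨b, hb, hB⟩ := ih h
      have hB' : HasSum (fun w : List Bool =>
        if (false :: w).length < N + 1 then wt q p (false :: w) (h+1) else 0) (p * b) := by
        refine (hB.mul_left p).congr_fun fun w => ?_
        simp [wt]
      refine ⟨_, ?_, hasSum_list hA' hB'⟩
      simp [wt]; nlinarith

theorem wt_sum_le {q p : ℝ} (hq : 0 ≤ q) (hp : 0 ≤ p) (hpq : q + p = 1) (h : ℕ)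
    (s : Finset (List Bool)) : ∑ w ∈ s, wt q p w h ≤ 1 := by
  obtain ⟨a, ha, hA⟩ := wt_trunc hq hp hpq (s.sup List.length + 1) h
  refine le_trans ?_ ha
  have : ∑ w ∈ s, wt q p w h
      = ∑ w ∈ s, if w.length < s.sup List.length + 1 then wt q p w h else 0 := by
    refine Finset.sum_congr rfl fun w hw => ?_
    rw [if_pos (Nat.lt_succ_of_le (Finset.le_sup (f := List.length) hw))]
  rw [this]
  refine sum_le_hasSum s (fun w _ => ?_) hA
  split_ifs
  · exact wt_nonneg hq hp w h
  · exact le_rfl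

theorem wt_hasSum {q p : ℝ} (hq : 0 < q) (hqp : q < p) (hpq : q + p = 1) (h : ℕ) :
    HasSum (fun w => wt q p w h) 1 := by
  have hp : 0 < p := hq.trans hqp
  have hs : ∀ h, Summable (fun w => wt q p w h) := fun h =>
    summable_of_sum_le (fun w => wt_nonneg hq.le hp.le w h) (wt_sum_le hq.le hp.le hpq h)
  obtain ⟨e, he⟩ : ∃ e : ℕ → ℝ, ∀ h, e h = 1 - ∑' w, wt q p w h := ⟨_, fun _ => rfl⟩
  have he0 : ∀ h, 0 ≤ e h := fun h => by
    have := (hs h).tsum_le_of_sum_le (wt_sum_le hq.le hp.le hpq h)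
    rw [he]; linarith
  have he1 : ∀ h, e h ≤ 1 := fun h => by
    have : 0 ≤ ∑' w, wt q p w h := tsum_nonneg (fun w => wt_nonneg hq.le hp.le w h)
    rw [he]; linarith
  have r0 : e 0 = q * e 1 := by
    have hA : HasSum (fun w : List Bool => wt q p (true :: w) 0) _ := (hs 1).hasSum.mul_left q
    have hB : HasSum (fun w : List Bool => wt q p (false :: w) 0) 0 := by
      simp [wt]
    have := (hasSum_list (f := fun w => wt q p w 0) hA hB).tsum_eq
    rw [he, he, this]; simp only [wt]; linarith
  have r1 : ∀ h, e (h + 1) = q * e (h + 2) + p * e h := fun h => by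
    have hA : HasSum (fun w : List Bool => wt q p (true :: w) (h + 1)) _ :=
      (hs (h + 2)).hasSum.mul_left q
    have hB : HasSum (fun w : List Bool => wt q p (false :: w) (h + 1)) _ :=
      (hs h).hasSum.mul_left p
    have := (hasSum_list (f := fun w => wt q p w (h + 1)) hA hB).tsum_eq
    rw [he, he, he, this]; simp only [wt]; linarith
  have d : ∀ h, e 0 ≤ e (h + 1) - e h := by
    intro h
    induction h with
    | zero =>
      have := he0 0
      have := he0 1
      simp only [zero_add]
      nlinarith
    | succ h ih =>
      have h1 := r1 h
      have h2 : q * (e (h + 2) - e (h + 1)) = p * (e (h + 1) - e h) := by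
        have : p = 1 - q := by linarith
        subst this; linarith
      have h3 := he0 0
      have h4 : q * (e (h + 1) - e h) ≤ p * (e (h + 1) - e h) := by
        apply mul_le_mul_of_nonneg_right hqp.le; linarith
      have h5 : e (h + 1) - e h ≤ e (h + 2) - e (h + 1) := by
        rw [← h2] at h4
        exact le_of_mul_le_mul_left h4 hq
      show e 0 ≤ e (h + 2) - e (h + 1)
      linarith
  have l : ∀ h : ℕ, h * e 0 ≤ e h := by
    intro h
    induction h with
    | zero => simpa using he0 0
    | succ h ih => have := d h; push_cast; linarith
  have z0 : e 0 = 0 := by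
    by_contra hne
    have hpos : 0 < e 0 := lt_of_le_of_ne (he0 0) (Ne.symm hne)
    obtain ⟨n, hn⟩ := exists_nat_gt (1 / e 0)
    rw [div_lt_iff₀ hpos] at hn
    linarith [l n, he1 n]
  have z : ∀ h, e h = 0 ∧ e (h + 1) = 0 := by
    intro h
    induction h with
    | zero =>
      refine ⟨z0, ?_⟩
      rw [z0] at r0
      rcases mul_eq_zero.1 r0.symm with h | h
      · exact absurd h hq.ne'
      · exact h
    | succ h ih =>
      refine ⟨ih.2, ?_⟩
      have := r1 h
      rw [ih.1, ih.2] at this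
      have : q * e (h + 2) = 0 := by linarith
      rcases mul_eq_zero.1 this with h | h
      · exact absurd h hq.ne'
      · exact h
  have hz := (z h).1
  rw [he] at hz
  have : ∑' w, wt q p w h = 1 := by linarith
  rw [← this]
  exact (hs h).hasSum

theorem sumA {q p : ℝ} (hq : 0 < q) (hqp : q < p) (hpq : q + p = 1) (n : ℕ) :
    ∀ h : ℕ, HasSum (fun w => if w.idxOf false < n then wt q p w h else 0) (1 - q ^ n) := by
  induction n with
  | zero => intro h; simp
  | succ n ih =>
    intro h
    have hA : HasSum (fun w : List Bool =>
        if (true :: w).idxOf false < n + 1 then wt q p (true :: w) h else 0)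
        (q * (1 - q ^ n)) := by
      refine ((ih (h + 1)).mul_left q).congr_fun fun w => ?_
      simp [wt, List.idxOf_cons]
    have hp : p = 1 - q := by linarith
    cases h with
    | zero =>
      have hB : HasSum (fun w : List Bool =>
        if (false :: w).idxOf false < n + 1 then wt q p (false :: w) 0 else 0) 0 := by
        simp [wt]
      refine hasSum_list_eq hA hB ?_
      simp [wt]; rw [hp]; ring
    | succ h =>
      have hB : HasSum (fun w : List Bool =>
        if (false :: w).idxOf false < n + 1 then wt q p (false :: w) (h + 1) else 0) (p * 1) := by
        refine ((wt_hasSum hq hqp hpq h).mul_left p).congr_fun fun w => ?_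
        simp [wt, List.idxOf_cons]
      refine hasSum_list_eq hA hB ?_
      simp [wt]; rw [hp]; ring

theorem sumC (q p : ℝ) (h : ℕ) :
    HasSum (fun w => if w.count true = 0 then wt q p w h else 0) (p ^ (h + 1)) := by
  have hA : ∀ h, HasSum (fun w : List Bool =>
        if (true :: w).count true = 0 then wt q p (true :: w) h else 0) 0 := by
    intro h
    simp
  induction h with
  | zero =>
    have hB : HasSum (fun w : List Bool =>
        if (false :: w).count true = 0 then wt q p (false :: w) 0 else 0) 0 := by
      simp [wt]
    refine hasSum_list_eq (hA 0) hB ?_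
    simp [wt]
  | succ h ih =>
    have hB : HasSum (fun w : List Bool =>
        if (false :: w).count true = 0 then wt q p (false :: w) (h + 1) else 0)
        (p * p ^ (h + 1)) := by
      refine (ih.mul_left p).congr_fun fun w => ?_
      simp [wt]
    refine hasSum_list_eq (hA (h + 1)) hB ?_
    simp [wt]; ring

theorem sumB (q p : ℝ) (n : ℕ) :
    ∀ h : ℕ, HasSum (fun w => if w.idxOf false < n ∧ w.count true ≤ w.idxOf false
      then wt q p w h else 0) (p ^ (h + 1) * ∑ j ∈ Finset.range n, (p * q) ^ j) := by
  induction n with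
  | zero => intro h; simp
  | succ n ih =>
    intro h
    have hA : HasSum (fun w : List Bool =>
        if (true :: w).idxOf false < n + 1 ∧ (true :: w).count true ≤ (true :: w).idxOf false
        then wt q p (true :: w) h else 0)
        (q * (p ^ (h + 1 + 1) * ∑ j ∈ Finset.range n, (p * q) ^ j)) := by
      refine ((ih (h + 1)).mul_left q).congr_fun fun w => ?_
      simp [wt, List.idxOf_cons]
    have key : p ^ (h + 1) * ∑ j ∈ Finset.range (n + 1), (p * q) ^ j =
        q * (p ^ (h + 1 + 1) * ∑ j ∈ Finset.range n, (p * q) ^ j) + p ^ (h + 1) := by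
      rw [Finset.sum_range_succ', mul_add]
      simp only [pow_succ _ _, ← Finset.sum_mul]
      ring
    rw [key]
    cases h with
    | zero =>
      have hB : HasSum (fun w : List Bool =>
        if (false :: w).idxOf false < n + 1 ∧ (false :: w).count true ≤ (false :: w).idxOf false
        then wt q p (false :: w) 0 else 0) 0 := by
        simp [wt]
      refine hasSum_list_eq hA hB ?_
      simp [wt]; ring
    | succ h =>
      have hB : HasSum (fun w : List Bool =>
        if (false :: w).idxOf false < n + 1 ∧ (false :: w).count true ≤ (false :: w).idxOf false
        then wt q p (false :: w) (h + 1) else 0) (p * p ^ (h + 1)) := by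
        refine ((sumC q p h).mul_left p).congr_fun fun w => ?_
        simp [wt, List.idxOf_cons]
      refine hasSum_list_eq hA hB ?_
      simp [wt]; ring

open Classical in
theorem wt_eq (q p : ℝ) (w : List Bool) (h : ℕ) :
    wt q p w h = if w.count true + h = w.count false ∧
      ∀ n : ℕ, (w.take n).count false ≤ (w.take n).count true + h
      then p * (q ^ w.count true * p ^ w.count false) else 0 := by
  have split : ∀ P : ℕ → Prop, (∀ n, P n) ↔ P 0 ∧ ∀ n, P (n + 1) := fun P =>
    ⟨fun H => ⟨H 0, fun n => H _⟩, fun H n => by cases n; exacts [H.1, H.2 _]⟩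
  induction w generalizing h with
  | nil => cases h <;> simp [wt]
  | cons b w ih =>
    rw [split]
    cases b
    · cases h with
      | zero =>
        simp only [wt]
        rw [if_neg]
        rintro ⟨-, -, H⟩
        have := H 0
        simp at this
      | succ h =>
        simp only [wt, ih]
        simp only [List.take_zero, List.take_succ_cons, List.count_cons_self, List.count_nil,
          zero_le, true_and, ← add_assoc, Nat.add_le_add_iff_right, Nat.add_right_cancel_iff,
          ne_eq, Bool.false_eq_true, not_false_eq_true, List.count_cons_of_ne]
        split_ifs
        · ring
        · simp
    · simp only [wt, ih]
      have e : ∀ a : ℕ, a + 1 + h = a + (h + 1) := fun a => by ring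
      simp only [List.take_zero, List.take_succ_cons, List.count_cons_self, List.count_nil,
        zero_le, true_and, e, ne_eq, Bool.true_eq_false, not_false_eq_true, List.count_cons_of_ne]
      split_ifs
      · ring
      · simp

theorem stmt8 (q p : ℝ) (hq : 0 < q) (hq1 : q < 1 / 2) (hp : p = 1 - q) (n : ℕ) :
    HasSum
      (fun w : {w : List Bool //
          IsDyck w ∧ firstH (w : List Bool) ≤ min ((w : List Bool).count true) n} =>
        p * (p * q) ^ ((w : List Bool).count true))
      ((1 - q ^ n) - p * (1 - (p * q) ^ n) / (1 - p * q)) := by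
  classical
  have hqp : q < p := by linarith
  have hpq : q + p = 1 := by linarith
  have hlt : p * q < 1 := by nlinarith
  have H := (sumA hq hqp hpq n 0).sub (sumB q p n 0)
  have hv : p ^ (0 + 1) * ∑ j ∈ Finset.range n, (p * q) ^ j
      = p * (1 - (p * q) ^ n) / (1 - p * q) := by
    rw [geom_sum_eq hlt.ne, zero_add, pow_one, mul_div_assoc, ← neg_div_neg_eq, neg_sub, neg_sub]
  rw [hv] at H
  refine (hasSum_subtype_iff_indicator (f := fun w : List Bool => p * (p * q) ^ (w.count true))
    (s := {w | IsDyck w ∧ firstH w ≤ min (w.count true) n})).2 ?_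
  refine H.congr_fun fun w => ?_
  rw [Set.indicator_apply, wt_eq]
  simp only [Set.mem_ofPred_eq, IsDyck, firstH, add_zero, le_min_iff]
  by_cases hD : w.count true = w.count false ∧
      ∀ n : ℕ, (w.take n).count false ≤ (w.take n).count true
  · have e : q ^ w.count true * p ^ w.count false = (p * q) ^ w.count true := by
      rw [← hD.1, mul_pow]; ring
    rw [if_pos hD, e]
    by_cases h1 : w.idxOf false < n <;> by_cases h2 : w.count true ≤ w.idxOf false
    · rw [if_pos h1, if_neg (by omega), if_pos ⟨h1, h2⟩]; simp
    · rw [if_pos h1, if_pos ⟨hD, by omega, by omega⟩, if_neg (by omega)]; simp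
    · rw [if_neg h1, if_neg (by omega), if_neg (by omega)]; simp
    · rw [if_neg h1, if_neg (by omega), if_neg (by omega)]; simp
  · rw [if_neg hD, if_neg (fun h => hD h.1)]; simp
end

section
/- Assume 0 < q < 1/2 and let n₁ ≥ 2 be an integer. Conditionally on X_1 = X_2 = +1, the expected number of indices i with 3 ≤ i ≤ τ such that S_i < S_{i−1} and S_i < n₁ equals (p/(p − q)) (1 − (q/p)^{n₁ − 1}). (These indices are the honest blocks of the cycle whose relative height is less than n₁ − 2, i.e., the count H(ω) of potential uncle positions.) -/
open MeasureTheory ProbabilityTheory Filter Finset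

open Classical in
/-- Indicator that the cycle started with `SS` and is still running after `m` blocks. -/
noncomputable def runInd {Ω : Type*} (X : ℕ → Ω → ℤ) (m : ℕ) (ω : Ω) : ℝ :=
  if X 1 ω = 1 ∧ X 2 ω = 1 ∧ ∀ j ∈ Finset.Icc 3 m, walkS X j ω ≠ 1 then 1 else 0

/-- Expected number of counted blocks during the passage from level `j+2` to level `j+1`. -/
noncomputable def cfun (p q : ℝ) (N j : ℕ) : ℝ :=
  if j + 1 < N then p / (p - q) * (1 - (q / p) ^ (N - (j + 1))) else 0

/-- Expected number of remaining counted blocks from level `k`. -/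
noncomputable def ffun (p q : ℝ) (N : ℕ) (k : ℤ) : ℝ :=
  ∑ j ∈ Finset.range (k - 1).toNat, cfun p q N j

lemma walkS_two {Ω : Type*} (X : ℕ → Ω → ℤ) (ω : Ω) :
    walkS X 2 ω = X 1 ω + X 2 ω := by
  rw [walkS_succ, walkS_succ]; simp [walkS]

lemma cfun_rec {p q : ℝ} (hq : 0 < q) (hqp : q < p) (N j : ℕ) :
    p * cfun p q N j - q * cfun p q N (j + 1) = if j + 1 < N then p else 0 := by
  have hp : p ≠ 0 := by linarith
  have hpq : p - q ≠ 0 := by linarith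
  unfold cfun
  by_cases h1 : j + 1 + 1 < N
  · rw [if_pos h1, if_pos (by omega), if_pos (by omega)]
    have : N - (j + 1) = (N - (j + 1 + 1)) + 1 := by omega
    rw [this, pow_succ]
    generalize (q / p) ^ (N - (j + 1 + 1)) = x
    field_simp
    ring
  · by_cases h2 : j + 1 < N
    · rw [if_neg h1, if_pos h2, if_pos h2]
      have : N - (j + 1) = 1 := by omega
      rw [this]
      field_simp
      ring
    · rw [if_neg h1, if_neg h2, if_neg h2]; ring

lemma cfun_nonneg {p q : ℝ} (hq : 0 < q) (hqp : q < p) (N j : ℕ) : 0 ≤ cfun p q N j := by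
  unfold cfun
  split_ifs
  · have h1 : (q / p) ^ (N - (j + 1)) ≤ 1 :=
      pow_le_one₀ (by have := hq.trans hqp; positivity) ((div_le_one (hq.trans hqp)).2 hqp.le)
    have h2 : 0 ≤ p / (p - q) := div_nonneg (by linarith) (by linarith)
    exact mul_nonneg h2 (by linarith)
  · exact le_rfl

lemma cfun_le {p q : ℝ} (hq : 0 < q) (hqp : q < p) (N j : ℕ) :
    cfun p q N j ≤ p / (p - q) := by
  have h2 : 0 ≤ p / (p - q) := div_nonneg (by linarith) (by linarith)
  unfold cfun
  split_ifs
  · have h1 : 0 ≤ (q / p) ^ (N - (j + 1)) := by have := hq.trans hqp; positivity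
    nlinarith
  · exact h2

lemma ffun_nonneg {p q : ℝ} (hq : 0 < q) (hqp : q < p) (N : ℕ) (k : ℤ) : 0 ≤ ffun p q N k :=
  Finset.sum_nonneg fun j _ => cfun_nonneg hq hqp N j

lemma ffun_le {p q : ℝ} (hq : 0 < q) (hqp : q < p) (N : ℕ) (k : ℤ) :
    ffun p q N k ≤ N * (p / (p - q)) := by
  have h2 : 0 ≤ p / (p - q) := div_nonneg (by linarith) (by linarith)
  have h3 : ∀ M : ℕ, ∑ j ∈ Finset.range M, cfun p q N j ≤ min (M : ℝ) (N : ℝ) * (p / (p - q)) := by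
    intro M
    induction M with
    | zero => simp
    | succ M ih =>
      rw [Finset.sum_range_succ]
      by_cases h : M + 1 < N
      · have := cfun_le hq hqp N M
        rw [min_eq_left (by exact_mod_cast (by omega : M ≤ N))] at ih
        rw [min_eq_left (by exact_mod_cast (by omega : M + 1 ≤ N))]
        push_cast
        linarith
      · have h0 : cfun p q N M = 0 := by unfold cfun; rw [if_neg h]
        rw [h0, add_zero]
        refine ih.trans (mul_le_mul_of_nonneg_right ?_ h2)
        exact min_le_min_right _ (by push_cast; linarith)
  exact (h3 _).trans (mul_le_mul_of_nonneg_right (min_le_right _ _) h2)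

lemma ffun_one (p q : ℝ) (N : ℕ) : ffun p q N 1 = 0 := by simp [ffun]

lemma ffun_two (p q : ℝ) (N : ℕ) : ffun p q N 2 = cfun p q N 0 := by simp [ffun]

lemma ffun_rec {p q : ℝ} (hq : 0 < q) (hqp : q < p) (hsum : p + q = 1) (N : ℕ) (k : ℤ)
    (hk : 2 ≤ k) :
    q * ffun p q N (k + 1) + p * ((if k + -1 < (N : ℤ) then 1 else 0) + ffun p q N (k + -1))
      = ffun p q N k := by
  obtain ⟨m, rfl⟩ : ∃ m : ℕ, k = m + 2 := ⟨(k - 2).toNat, by omega⟩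
  have h := cfun_rec hq hqp N m
  unfold ffun
  have e1 : ((m : ℤ) + 2 + 1 - 1).toNat = m + 1 + 1 := by omega
  have e2 : ((m : ℤ) + 2 + -1 - 1).toNat = m := by omega
  have e3 : ((m : ℤ) + 2 - 1).toNat = m + 1 := by omega
  rw [e1, e2, e3, Finset.sum_range_succ, Finset.sum_range_succ]
  have e4 : ((m : ℤ) + 2 + -1 < (N : ℤ)) ↔ m + 1 < N := by omega
  have hpe : p = 1 - q := by linarith
  by_cases h1 : m + 1 < N
  · rw [if_pos (e4.2 h1)]
    rw [if_pos h1] at h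
    subst hpe
    linarith
  · rw [if_neg (fun h' => h1 (e4.1 h'))]
    rw [if_neg h1] at h
    subst hpe
    linarith

lemma meas_walk {Ω : Type*} [MeasurableSpace Ω] (X : ℕ → Ω → ℤ) (m : ℕ)
    (h : ∀ i ∈ Set.Icc 1 m, Measurable (X i)) : Measurable (walkS X m) := by
  unfold walkS
  refine Finset.measurable_sum _ fun i hi => h i ?_
  simpa using hi

lemma meas_runInd {Ω : Type*} [MeasurableSpace Ω] (X : ℕ → Ω → ℤ) (m : ℕ) (hm : 2 ≤ m)
    (h : ∀ i ∈ Set.Icc 1 m, Measurable (X i)) : Measurable (runInd X m) := by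
  unfold runInd
  refine Measurable.ite ?_ measurable_const measurable_const
  have hs : {ω | X 1 ω = 1 ∧ X 2 ω = 1 ∧ ∀ j ∈ Finset.Icc 3 m, walkS X j ω ≠ 1}
      = X 1 ⁻¹' {1} ∩ (X 2 ⁻¹' {1} ∩ ⋂ j ∈ Finset.Icc 3 m, walkS X j ⁻¹' {1}ᶜ) := by
    ext ω; simp
  rw [hs]
  refine (h 1 ⟨le_rfl, by omega⟩ (measurableSet_singleton _)).inter
    ((h 2 ⟨by omega, hm⟩ (measurableSet_singleton _)).inter ?_)
  refine Finset.measurableSet_biInter _ fun j hj => ?_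
  rw [Finset.mem_Icc] at hj
  exact meas_walk X j (fun i hi => h i ⟨hi.1, hi.2.trans hj.2⟩) (measurableSet_singleton _).compl

lemma meas_Y {Ω : Type*} [MeasurableSpace Ω] (X : ℕ → Ω → ℤ) (m : ℕ) (hm : 2 ≤ m)
    (h : ∀ i ∈ Set.Icc 1 m, Measurable (X i)) (g : ℤ → ℝ) :
    Measurable fun ω => runInd X m ω * g (walkS X m ω) :=
  (meas_runInd X m hm h).mul ((measurable_of_countable g).comp (meas_walk X m h))

lemma runInd_nonneg {Ω : Type*} (X : ℕ → Ω → ℤ) (m : ℕ) (ω : Ω) : 0 ≤ runInd X m ω := by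
  unfold runInd; split_ifs <;> norm_num

lemma runInd_le {Ω : Type*} (X : ℕ → Ω → ℤ) (m : ℕ) (ω : Ω) : runInd X m ω ≤ 1 := by
  unfold runInd; split_ifs <;> norm_num

lemma runInd_anti {Ω : Type*} (X : ℕ → Ω → ℤ) (ω : Ω) : Antitone fun m => runInd X m ω := by
  intro a b hab
  simp only [runInd]
  split_ifs with h1 h2 h2
  · exact le_rfl
  · exact absurd ⟨h1.1, h1.2.1, fun j hj => h1.2.2 j (Finset.Icc_subset_Icc_right hab hj)⟩ h2
  · norm_num
  · exact le_rfl

/-- Stopped `g` vanishing at `1`. -/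
lemma runInd_succ_mul {Ω : Type*} (X : ℕ → Ω → ℤ) (m : ℕ) (hm : 2 ≤ m) (ω : Ω) (g : ℤ → ℝ)
    (hg : g 1 = 0) :
    runInd X (m + 1) ω * g (walkS X (m + 1) ω) = runInd X m ω * g (walkS X (m + 1) ω) := by
  by_cases h : walkS X (m + 1) ω = 1
  · rw [h, hg]; simp
  · congr 1
    unfold runInd
    congr 1
    simp only [Finset.mem_Icc, eq_iff_iff]
    constructor
    · rintro ⟨h1, h2, h3⟩
      exact ⟨h1, h2, fun j hj => h3 j ⟨hj.1, by omega⟩⟩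
    · rintro ⟨h1, h2, h3⟩
      refine ⟨h1, h2, fun j hj => ?_⟩
      by_cases hj' : j = m + 1
      · rw [hj']; exact h
      · exact h3 j ⟨hj.1, by omega⟩

lemma walk_ge {Ω : Type*} (X : ℕ → Ω → ℤ) (ω : Ω) (hX : ∀ i, X i ω = 1 ∨ X i ω = -1)
    (m : ℕ) (hm : 2 ≤ m) (h : runInd X m ω ≠ 0) : 2 ≤ walkS X m ω := by
  have h' : X 1 ω = 1 ∧ X 2 ω = 1 ∧ ∀ j ∈ Finset.Icc 3 m, walkS X j ω ≠ 1 := by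
    by_contra hc
    exact h (by unfold runInd; rw [if_neg hc])
  clear h
  obtain ⟨h1, h2, h3⟩ := h'
  induction m, hm using Nat.le_induction with
  | base => rw [walkS_two, h1, h2]; norm_num
  | succ m hm ih =>
    have h4 := ih fun j hj => h3 j (Finset.Icc_subset_Icc_right (by omega) hj)
    have h5 := h3 (m + 1) (by simp; omega)
    rw [walkS_succ] at h5 ⊢
    rcases hX (m + 1) with h | h <;> rw [h] at h5 ⊢ <;> omega

lemma walk_le {Ω : Type*} (X : ℕ → Ω → ℤ) (ω : Ω) (hX : ∀ i, X i ω = 1 ∨ X i ω = -1)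
    (m : ℕ) : walkS X m ω ≤ m := by
  induction m with
  | zero => simp [walkS]
  | succ m ih =>
    rw [walkS_succ]
    push_cast
    rcases hX (m + 1) with h | h <;> rw [h] <;> omega

lemma indep_step {Ω : Type*} [MeasurableSpace Ω] {μ : Measure Ω} [IsProbabilityMeasure μ]
    (X : ℕ → Ω → ℤ) (hmeas : ∀ i, Measurable (X i)) (hindep : iIndepFun X μ)
    (m : ℕ) (hm : 2 ≤ m) (g : ℤ → ℝ) (s : ℤ) :
    ∫ ω, (runInd X m ω * g (walkS X m ω)) * (if X (m + 1) ω = s then 1 else 0) ∂μ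
      = (∫ ω, runInd X m ω * g (walkS X m ω) ∂μ) * μ.real {ω | X (m + 1) ω = s} := by
  have hd : Disjoint (Set.Icc 1 m) ({m + 1} : Set ℕ) := by simp
  have hI := indep_iSup_of_disjoint (fun i => (hmeas i).comap_le) hindep hd
  have hY : Measurable[⨆ i ∈ Set.Icc 1 m, MeasurableSpace.comap (X i) inferInstance]
      (fun ω => runInd X m ω * g (walkS X m ω)) := by
    refine @meas_Y Ω (⨆ i ∈ Set.Icc 1 m, MeasurableSpace.comap (X i) inferInstance) X m hm ?_ g
    intro i hi
    rw [measurable_iff_comap_le]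
    exact le_iSup₂_of_le i hi le_rfl
  have hZ0 : Measurable (fun x : ℤ => if x = s then (1 : ℝ) else 0) := measurable_of_countable _
  have hZ : Measurable[⨆ i ∈ ({m + 1} : Set ℕ), MeasurableSpace.comap (X i) inferInstance]
      (fun ω => if X (m + 1) ω = s then (1 : ℝ) else 0) := by
    refine hZ0.comp ?_
    rw [measurable_iff_comap_le]
    exact le_iSup₂_of_le (m + 1) rfl le_rfl
  have hF : IndepFun (fun ω => runInd X m ω * g (walkS X m ω))
      (fun ω => if X (m + 1) ω = s then (1 : ℝ) else 0) μ := by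
    rw [IndepFun_iff_Indep]
    exact indep_of_indep_of_le_left (indep_of_indep_of_le_right hI hZ.comap_le) hY.comap_le
  rw [hF.integral_fun_mul_eq_mul_integral
    (meas_Y X m hm (fun i _ => hmeas i) g).aestronglyMeasurable
    (hZ0.comp (hmeas (m + 1))).aestronglyMeasurable]
  congr 1
  have : (fun ω => if X (m + 1) ω = s then (1 : ℝ) else 0)
      = Set.indicator {ω | X (m + 1) ω = s} 1 := by
    ext ω; simp [Set.indicator]
  rw [this, integral_indicator_one]
  exact hmeas (m + 1) (measurableSet_singleton s)

lemma int_Y {Ω : Type*} [MeasurableSpace Ω] {μ : Measure Ω} [IsProbabilityMeasure μ]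
    (X : ℕ → Ω → ℤ) (hmeas : ∀ i, Measurable (X i)) (m : ℕ) (hm : 2 ≤ m)
    (Z : Ω → ℝ) (hZ : Measurable Z) (C : ℝ) (hC : ∀ ω, |Z ω| ≤ C) :
    Integrable (fun ω => runInd X m ω * Z ω) μ := by
  refine Integrable.of_bound
    ((meas_runInd X m hm (fun i _ => hmeas i)).mul hZ).aestronglyMeasurable C ?_
  refine Eventually.of_forall fun ω => ?_
  rw [Real.norm_eq_abs, abs_mul, abs_of_nonneg (runInd_nonneg X m ω)]
  have := hC ω
  have h2 := abs_nonneg (Z ω)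
  have := runInd_le X m ω
  nlinarith

lemma markov_step {Ω : Type*} [MeasurableSpace Ω] {μ : Measure Ω} [IsProbabilityMeasure μ]
    {p q : ℝ} (X : ℕ → Ω → ℤ) (hmeas : ∀ i, Measurable (X i)) (hindep : iIndepFun X μ)
    (hup : ∀ i, μ.real {ω | X i ω = 1} = q) (hdown : ∀ i, μ.real {ω | X i ω = -1} = p)
    (hX : ∀ᵐ ω ∂μ, ∀ i, X i ω = 1 ∨ X i ω = -1)
    (m : ℕ) (hm : 2 ≤ m) (Ψ : ℤ → ℤ → ℝ) (C : ℝ) (hC : ∀ s x, |Ψ s x| ≤ C) :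
    ∫ ω, runInd X m ω * Ψ (walkS X m ω) (X (m + 1) ω) ∂μ
      = ∫ ω, runInd X m ω * (q * Ψ (walkS X m ω) 1 + p * Ψ (walkS X m ω) (-1)) ∂μ := by
  have hS : Measurable (walkS X m) := meas_walk X m fun i _ => hmeas i
  have hi : ∀ s, Integrable (fun ω => runInd X m ω * Ψ (walkS X m ω) s) μ := fun s =>
    int_Y X hmeas m hm _ ((measurable_of_countable fun k => Ψ k s).comp hS) C fun ω => hC _ _
  have hi2 : ∀ s, Integrable (fun ω => (runInd X m ω * Ψ (walkS X m ω) s) *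
      (if X (m + 1) ω = s then 1 else 0)) μ := by
    intro s
    have := int_Y (μ := μ) X hmeas m hm
      (fun ω => Ψ (walkS X m ω) s * (if X (m + 1) ω = s then 1 else 0))
      (((measurable_of_countable fun k => Ψ k s).comp hS).mul
        ((measurable_of_countable (fun x : ℤ => if x = s then (1 : ℝ) else 0)).comp
          (hmeas (m + 1)))) C (fun ω => by
        have h0 := hC (walkS X m ω) s
        have := (abs_nonneg _).trans h0
        split_ifs <;> simp [h0, this])
    refine this.congr (Eventually.of_forall fun ω => ?_)
    simp only
    ring
  calc _ = ∫ ω, ((runInd X m ω * Ψ (walkS X m ω) 1) * (if X (m + 1) ω = 1 then 1 else 0)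
        + (runInd X m ω * Ψ (walkS X m ω) (-1)) * (if X (m + 1) ω = -1 then 1 else 0)) ∂μ := by
        refine integral_congr_ae ?_
        filter_upwards [hX] with ω h
        rcases h (m + 1) with h | h <;> simp [h]
    _ = (∫ ω, runInd X m ω * Ψ (walkS X m ω) 1 ∂μ) * q
        + (∫ ω, runInd X m ω * Ψ (walkS X m ω) (-1) ∂μ) * p := by
        rw [integral_add (hi2 1) (hi2 (-1)),
          indep_step X hmeas hindep m hm (fun k => Ψ k 1) 1,
          indep_step X hmeas hindep m hm (fun k => Ψ k (-1)) (-1), hup, hdown]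
    _ = _ := by
        rw [← integral_mul_const, ← integral_mul_const,
          ← integral_add ((hi 1).mul_const q) ((hi (-1)).mul_const p)]
        congr 1
        ext ω
        ring

/-- Indicator that block `m+1` is counted. -/
noncomputable def dfun {Ω : Type*} (X : ℕ → Ω → ℤ) (N m : ℕ) (ω : Ω) : ℝ :=
  if walkS X (m + 1) ω < walkS X m ω ∧ walkS X (m + 1) ω < N then 1 else 0

lemma dfun_eq {Ω : Type*} (X : ℕ → Ω → ℤ) (N m : ℕ) (ω : Ω) :
    dfun X N m ω = if X (m + 1) ω < 0 ∧ walkS X m ω + X (m + 1) ω < N then 1 else 0 := by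
  unfold dfun
  rw [walkS_succ]
  congr 1
  simp

lemma meas_dfun {Ω : Type*} [MeasurableSpace Ω] (X : ℕ → Ω → ℤ)
    (hmeas : ∀ i, Measurable (X i)) (N m : ℕ) : Measurable (dfun X N m) := by
  have hS : ∀ m, Measurable (walkS X m) := fun m => meas_walk X m fun i _ => hmeas i
  have : Measurable (fun z : ℤ × ℤ => if z.1 < z.2 ∧ z.1 < N then (1 : ℝ) else 0) :=
    measurable_of_countable _
  exact this.comp ((hS (m + 1)).prodMk (hS m))

lemma dfun_abs {Ω : Type*} (X : ℕ → Ω → ℤ) (N m : ℕ) (ω : Ω) : |dfun X N m ω| ≤ 1 := by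
  unfold dfun; split_ifs <;> norm_num

lemma dfun_nonneg {Ω : Type*} (X : ℕ → Ω → ℤ) (N m : ℕ) (ω : Ω) : 0 ≤ dfun X N m ω := by
  unfold dfun; split_ifs <;> norm_num

set_option linter.unusedVariables false

lemma step_id {Ω : Type*} [MeasurableSpace Ω] {μ : Measure Ω} [IsProbabilityMeasure μ]
    {p q : ℝ} (X : ℕ → Ω → ℤ) (hmeas : ∀ i, Measurable (X i)) (hindep : iIndepFun X μ)
    (hup : ∀ i, μ.real {ω | X i ω = 1} = q) (hdown : ∀ i, μ.real {ω | X i ω = -1} = p)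
    (hX : ∀ᵐ ω ∂μ, ∀ i, X i ω = 1 ∨ X i ω = -1)
    (hq : 0 < q) (hqp : q < p) (hsum : p + q = 1)
    (N m : ℕ) (hm : 2 ≤ m) :
    ∫ ω, runInd X m ω * dfun X N m ω ∂μ
      = ∫ ω, runInd X m ω * ffun p q N (walkS X m ω) ∂μ
        - ∫ ω, runInd X (m + 1) ω * ffun p q N (walkS X (m + 1) ω) ∂μ := by
  have hS : ∀ m, Measurable (walkS X m) := fun m => meas_walk X m fun i _ => hmeas i
  have hb : ∀ k, |ffun p q N k| ≤ N * (p / (p - q)) := fun k => by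
    rw [abs_of_nonneg (ffun_nonneg hq hqp N k)]; exact ffun_le hq hqp N k
  have key := markov_step X hmeas hindep hup hdown hX m hm
    (fun s x => (if x < 0 ∧ s + x < N then (1 : ℝ) else 0) + ffun p q N (s + x))
    (1 + N * (p / (p - q))) (fun s x => by
      refine (abs_add_le _ _).trans (add_le_add ?_ (hb _))
      split_ifs <;> norm_num)
  have e1 : ∫ ω, runInd X m ω * ((if X (m + 1) ω < 0 ∧ walkS X m ω + X (m + 1) ω < N
        then (1 : ℝ) else 0) + ffun p q N (walkS X m ω + X (m + 1) ω)) ∂μ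
      = ∫ ω, runInd X m ω * dfun X N m ω ∂μ
        + ∫ ω, runInd X (m + 1) ω * ffun p q N (walkS X (m + 1) ω) ∂μ := by
    rw [← integral_add]
    · congr 1
      ext ω
      rw [runInd_succ_mul X m hm ω _ (ffun_one p q N), dfun_eq, walkS_succ]
      ring
    · exact int_Y X hmeas m hm _ (meas_dfun X hmeas N m) 1 (dfun_abs X N m)
    · exact int_Y X hmeas (m + 1) (by omega) _
        ((measurable_of_countable (ffun p q N)).comp (hS (m + 1))) _ (fun ω => hb _)
  have e2 : ∫ ω, runInd X m ω * (q * ((if (1 : ℤ) < 0 ∧ walkS X m ω + 1 < N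
        then (1 : ℝ) else 0) + ffun p q N (walkS X m ω + 1))
        + p * ((if (-1 : ℤ) < 0 ∧ walkS X m ω + -1 < N
        then (1 : ℝ) else 0) + ffun p q N (walkS X m ω + -1))) ∂μ
      = ∫ ω, runInd X m ω * ffun p q N (walkS X m ω) ∂μ := by
    refine integral_congr_ae ?_
    filter_upwards [hX] with ω h
    by_cases h0 : runInd X m ω = 0
    · simp only [h0, zero_mul]
    · have := ffun_rec hq hqp hsum N _ (walk_ge X ω h m hm h0)
      rw [← this]
      simp
  rw [e1, e2] at key
  linarith

lemma step_full {Ω : Type*} [MeasurableSpace Ω] {μ : Measure Ω} [IsProbabilityMeasure μ]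
    {p q : ℝ} (X : ℕ → Ω → ℤ) (hmeas : ∀ i, Measurable (X i)) (hindep : iIndepFun X μ)
    (hup : ∀ i, μ.real {ω | X i ω = 1} = q) (hdown : ∀ i, μ.real {ω | X i ω = -1} = p)
    (hX : ∀ᵐ ω ∂μ, ∀ i, X i ω = 1 ∨ X i ω = -1)
    (hq : 0 < q) (hqp : q < p) (hsum : p + q = 1)
    (N m : ℕ) (hm : 2 ≤ m) (hN : m ≤ N) :
    ∫ ω, runInd X m ω * dfun X N m ω ∂μ = p * ∫ ω, runInd X m ω ∂μ := by
  have key := markov_step X hmeas hindep hup hdown hX m hm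
    (fun s x => (if x < 0 ∧ s + x < N then (1 : ℝ) else 0)) 1
    (fun s x => by split_ifs <;> norm_num)
  simp only [← dfun_eq] at key
  rw [key, ← integral_const_mul]
  refine integral_congr_ae ?_
  filter_upwards [hX] with ω h
  have := walk_le X ω h m
  have h2 : walkS X m ω + -1 < N := by omega
  simp only [h2]
  norm_num
  ring

lemma int_two {Ω : Type*} [MeasurableSpace Ω] {μ : Measure Ω} [IsProbabilityMeasure μ]
    {p q : ℝ} (X : ℕ → Ω → ℤ) (hmeas : ∀ i, Measurable (X i)) (hindep : iIndepFun X μ)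
    (hup : ∀ i, μ.real {ω | X i ω = 1} = q) (hdown : ∀ i, μ.real {ω | X i ω = -1} = p)
    (hX : ∀ᵐ ω ∂μ, ∀ i, X i ω = 1 ∨ X i ω = -1)
    (hq : 0 < q) (hqp : q < p) (hsum : p + q = 1)
    (N : ℕ) : ∫ ω, runInd X 2 ω * ffun p q N (walkS X 2 ω) ∂μ
    = cfun p q N 0 * μ.real {ω | X 1 ω = 1 ∧ X 2 ω = 1} := by
  have hA : MeasurableSet {ω | X 1 ω = 1 ∧ X 2 ω = 1} :=
    (hmeas 1 (measurableSet_singleton 1)).inter (hmeas 2 (measurableSet_singleton 1))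
  rw [← integral_indicator_one hA, ← integral_const_mul]
  congr 1
  ext ω
  by_cases h : X 1 ω = 1 ∧ X 2 ω = 1
  · have : walkS X 2 ω = 2 := by rw [walkS_two, h.1, h.2]; norm_num
    rw [this, ffun_two]
    simp [runInd, h]
  · have h' : runInd X 2 ω = 0 := by
      unfold runInd; rw [if_neg]; exact fun hc => h ⟨hc.1, hc.2.1⟩
    rw [h', Set.indicator_of_notMem (by exact h)]
    simp

lemma partial_sum {Ω : Type*} [MeasurableSpace Ω] {μ : Measure Ω} [IsProbabilityMeasure μ]
    {p q : ℝ} (X : ℕ → Ω → ℤ) (hmeas : ∀ i, Measurable (X i)) (hindep : iIndepFun X μ)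
    (hup : ∀ i, μ.real {ω | X i ω = 1} = q) (hdown : ∀ i, μ.real {ω | X i ω = -1} = p)
    (hX : ∀ᵐ ω ∂μ, ∀ i, X i ω = 1 ∨ X i ω = -1)
    (hq : 0 < q) (hqp : q < p) (hsum : p + q = 1)
    (N n : ℕ) :
    ∑ k ∈ Finset.range n, ∫ ω, runInd X (k + 2) ω * dfun X N (k + 2) ω ∂μ
      = cfun p q N 0 * μ.real {ω | X 1 ω = 1 ∧ X 2 ω = 1}
        - ∫ ω, runInd X (n + 2) ω * ffun p q N (walkS X (n + 2) ω) ∂μ := by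
  induction n with
  | zero =>
    rw [← int_two X hmeas hindep hup hdown hX hq hqp hsum N]
    simp
  | succ n ih =>
    rw [Finset.sum_range_succ, ih,
      step_id X hmeas hindep hup hdown hX hq hqp hsum N (n + 2) (by omega)]
    have : n + 1 + 2 = n + 2 + 1 := by omega
    rw [this]
    ring

lemma int_run {Ω : Type*} [MeasurableSpace Ω] {μ : Measure Ω} [IsProbabilityMeasure μ]
    {p q : ℝ} (X : ℕ → Ω → ℤ) (hmeas : ∀ i, Measurable (X i)) (hindep : iIndepFun X μ)
    (hup : ∀ i, μ.real {ω | X i ω = 1} = q) (hdown : ∀ i, μ.real {ω | X i ω = -1} = p)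
    (hX : ∀ᵐ ω ∂μ, ∀ i, X i ω = 1 ∨ X i ω = -1)
    (hq : 0 < q) (hqp : q < p) (hsum : p + q = 1)
    (m : ℕ) (hm : 2 ≤ m) : Integrable (runInd X m) μ := by
  have := int_Y (μ := μ) X hmeas m hm (fun _ => 1) measurable_const 1 (by simp)
  simpa using this

lemma run_bound {Ω : Type*} [MeasurableSpace Ω] {μ : Measure Ω} [IsProbabilityMeasure μ]
    {p q : ℝ} (X : ℕ → Ω → ℤ) (hmeas : ∀ i, Measurable (X i)) (hindep : iIndepFun X μ)
    (hup : ∀ i, μ.real {ω | X i ω = 1} = q) (hdown : ∀ i, μ.real {ω | X i ω = -1} = p)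
    (hX : ∀ᵐ ω ∂μ, ∀ i, X i ω = 1 ∨ X i ω = -1)
    (hq : 0 < q) (hqp : q < p) (hsum : p + q = 1)
    (n : ℕ) : n * ∫ ω, runInd X (n + 2) ω ∂μ ≤ 1 / (p - q) := by
  have h := partial_sum X hmeas hindep hup hdown hX hq hqp hsum (n + 2) n
  have h1 : ∑ k ∈ Finset.range n, ∫ ω, runInd X (k + 2) ω * dfun X (n + 2) (k + 2) ω ∂μ
      ≥ ∑ k ∈ Finset.range n, p * ∫ ω, runInd X (n + 2) ω ∂μ := by
    refine Finset.sum_le_sum fun k hk => ?_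
    rw [Finset.mem_range] at hk
    rw [step_full X hmeas hindep hup hdown hX hq hqp hsum (n + 2) (k + 2) (by omega) (by omega)]
    refine mul_le_mul_of_nonneg_left ?_ (by linarith)
    refine integral_mono (int_run X hmeas hindep hup hdown hX hq hqp hsum _ (by omega))
      (int_run X hmeas hindep hup hdown hX hq hqp hsum _ (by omega)) fun ω => ?_
    exact runInd_anti X ω (by omega)
  rw [h] at h1
  have h2 : 0 ≤ ∫ ω, runInd X (n + 2) ω * ffun p q (n + 2) (walkS X (n + 2) ω) ∂μ :=
    integral_nonneg fun ω => mul_nonneg (runInd_nonneg X _ ω) (ffun_nonneg hq hqp _ _)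
  have h3 : cfun p q (n + 2) 0 * μ.real {ω | X 1 ω = 1 ∧ X 2 ω = 1} ≤ p / (p - q) := by
    have a := cfun_le hq hqp (n + 2) 0
    have b := cfun_nonneg hq hqp (n + 2) 0
    have c : μ.real {ω | X 1 ω = 1 ∧ X 2 ω = 1} ≤ 1 := measureReal_le_one
    nlinarith
  rw [Finset.sum_const, Finset.card_range, nsmul_eq_mul] at h1
  have hp : 0 < p := by linarith
  have h4 : p * (n * ∫ ω, runInd X (n + 2) ω ∂μ) ≤ p * (1 / (p - q)) := by
    have : p * (1 / (p - q)) = p / (p - q) := by ring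
    rw [this]
    linarith
  exact le_of_mul_le_mul_left h4 hp

lemma run_tendsto {Ω : Type*} [MeasurableSpace Ω] {μ : Measure Ω} [IsProbabilityMeasure μ]
    {p q : ℝ} (X : ℕ → Ω → ℤ) (hmeas : ∀ i, Measurable (X i)) (hindep : iIndepFun X μ)
    (hup : ∀ i, μ.real {ω | X i ω = 1} = q) (hdown : ∀ i, μ.real {ω | X i ω = -1} = p)
    (hX : ∀ᵐ ω ∂μ, ∀ i, X i ω = 1 ∨ X i ω = -1)
    (hq : 0 < q) (hqp : q < p) (hsum : p + q = 1)
    : Tendsto (fun n : ℕ => ∫ ω, runInd X (n + 2) ω ∂μ) atTop (nhds 0) := by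
  have h0 : Tendsto (fun n : ℕ => (1 / (p - q)) / (n : ℝ)) atTop (nhds 0) :=
    tendsto_const_div_atTop_nhds_zero_nat _
  refine squeeze_zero' (Eventually.of_forall fun n => integral_nonneg fun ω => runInd_nonneg X _ ω)
    ?_ h0
  filter_upwards [eventually_gt_atTop 0] with n hn
  rw [le_div_iff₀ (by exact_mod_cast hn), mul_comm]
  exact run_bound X hmeas hindep hup hdown hX hq hqp hsum n

lemma run_ae {Ω : Type*} [MeasurableSpace Ω] {μ : Measure Ω} [IsProbabilityMeasure μ]
    {p q : ℝ} (X : ℕ → Ω → ℤ) (hmeas : ∀ i, Measurable (X i)) (hindep : iIndepFun X μ)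
    (hup : ∀ i, μ.real {ω | X i ω = 1} = q) (hdown : ∀ i, μ.real {ω | X i ω = -1} = p)
    (hX : ∀ᵐ ω ∂μ, ∀ i, X i ω = 1 ∨ X i ω = -1)
    (hq : 0 < q) (hqp : q < p) (hsum : p + q = 1)
    : ∀ᵐ ω ∂μ, ∃ n, runInd X (n + 2) ω = 0 := by
  have hms : MeasurableSet {ω | ∃ n, runInd X (n + 2) ω = 0} := by
    rw [Set.ofPred_exists]
    exact MeasurableSet.iUnion fun n =>
      (meas_runInd X (n + 2) (by omega) fun i _ => hmeas i) (measurableSet_singleton 0)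
  have hgm : μ.real {ω | ∃ n, runInd X (n + 2) ω = 0}ᶜ ≤ 0 := by
    refine ge_of_tendsto' (run_tendsto X hmeas hindep hup hdown hX hq hqp hsum) fun n => ?_
    rw [← integral_indicator_one hms.compl]
    refine integral_mono ((integrable_const 1).indicator hms.compl)
      (int_run X hmeas hindep hup hdown hX hq hqp hsum _ (by omega)) fun ω => ?_
    by_cases h : ω ∈ {ω | ∃ n, runInd X (n + 2) ω = 0}ᶜ
    · rw [Set.indicator_of_mem h]
      have : runInd X (n + 2) ω ≠ 0 := fun hc => h ⟨n, hc⟩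
      unfold runInd at this ⊢
      split_ifs at this ⊢ with h1
      · simp
      · simp at this
    · rw [Set.indicator_of_notMem h]
      exact runInd_nonneg X _ ω
  rw [ae_iff]
  have h0 : μ.real {ω | ∃ n, runInd X (n + 2) ω = 0}ᶜ = 0 := le_antisymm hgm measureReal_nonneg
  rw [measureReal_eq_zero_iff] at h0
  exact h0

lemma total_hasSum {Ω : Type*} [MeasurableSpace Ω] {μ : Measure Ω} [IsProbabilityMeasure μ]
    {p q : ℝ} (X : ℕ → Ω → ℤ) (hmeas : ∀ i, Measurable (X i)) (hindep : iIndepFun X μ)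
    (hup : ∀ i, μ.real {ω | X i ω = 1} = q) (hdown : ∀ i, μ.real {ω | X i ω = -1} = p)
    (hX : ∀ᵐ ω ∂μ, ∀ i, X i ω = 1 ∨ X i ω = -1)
    (hq : 0 < q) (hqp : q < p) (hsum : p + q = 1)
    (N : ℕ) :
    HasSum (fun k : ℕ => ∫ ω, runInd X (k + 2) ω * dfun X N (k + 2) ω ∂μ)
      (cfun p q N 0 * μ.real {ω | X 1 ω = 1 ∧ X 2 ω = 1}) := by
  rw [hasSum_iff_tendsto_nat_of_nonneg]
  · simp only [partial_sum X hmeas hindep hup hdown hX hq hqp hsum N]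
    have : Tendsto (fun n : ℕ => ∫ ω, runInd X (n + 2) ω * ffun p q N (walkS X (n + 2) ω) ∂μ)
        atTop (nhds 0) := by
      have h0 := (run_tendsto X hmeas hindep hup hdown hX hq hqp hsum).mul_const
        (N * (p / (p - q)))
      rw [zero_mul] at h0
      refine squeeze_zero (fun n => integral_nonneg fun ω =>
        mul_nonneg (runInd_nonneg X _ ω) (ffun_nonneg hq hqp _ _)) (fun n => ?_) h0
      rw [← integral_mul_const]
      refine integral_mono (int_Y X hmeas (n + 2) (by omega) _
        ((measurable_of_countable (ffun p q N)).comp (meas_walk X (n + 2) fun i _ => hmeas i))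
        (N * (p / (p - q))) fun ω => ?_)
        ((int_run X hmeas hindep hup hdown hX hq hqp hsum _ (by omega)).mul_const _) fun ω => ?_
      · rw [abs_of_nonneg (ffun_nonneg hq hqp N _)]
        exact ffun_le hq hqp N _
      · exact mul_le_mul_of_nonneg_left (ffun_le hq hqp N _) (runInd_nonneg X _ ω)
    simpa using (tendsto_const_nhds (x := cfun p q N 0 *
      μ.real {ω | X 1 ω = 1 ∧ X 2 ω = 1})).sub this
  · exact fun k => integral_nonneg fun ω => mul_nonneg (runInd_nonneg X _ ω) (dfun_nonneg X _ _ ω)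

lemma pointwise {Ω : Type*} (X : ℕ → Ω → ℤ) (N : ℕ) (ω : Ω) (hA : X 1 ω = 1 ∧ X 2 ω = 1)
    (h : ∃ n, runInd X (n + 2) ω = 0) :
    ∑' k : ℕ, runInd X (k + 2) ω * dfun X N (k + 2) ω
      = ∑ i ∈ Finset.Icc 3 (cycleTau X ω),
        if walkS X i ω < walkS X (i - 1) ω ∧ walkS X i ω < N then (1 : ℝ) else 0 := by
  have hne : {n : ℕ | 3 ≤ n ∧ walkS X n ω = 1}.Nonempty := by
    by_contra hc
    obtain ⟨n, hn⟩ := h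
    unfold runInd at hn
    rw [if_pos] at hn
    · norm_num at hn
    · refine ⟨hA.1, hA.2, fun j hj h1 => hc ⟨j, (Finset.mem_Icc.1 hj).1, h1⟩⟩
  have hmem := Nat.sInf_mem hne
  have hrun : ∀ k, runInd X (k + 2) ω = if k + 3 ≤ cycleTau X ω then 1 else 0 := by
    intro k
    unfold runInd
    congr 1
    rw [eq_iff_iff]
    constructor
    · rintro ⟨_, _, h3⟩
      by_contra hc
      exact h3 (cycleTau X ω) (Finset.mem_Icc.2 ⟨hmem.1, by omega⟩) hmem.2
    · intro hk
      refine ⟨hA.1, hA.2, fun j hj h1 => ?_⟩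
      rw [Finset.mem_Icc] at hj
      have : cycleTau X ω ≤ j := Nat.sInf_le ⟨hj.1, h1⟩
      omega
  rw [tsum_eq_sum (s := Finset.range (cycleTau X ω - 2))]
  · have h3 : Finset.Icc 3 (cycleTau X ω)
        = (Finset.range (cycleTau X ω - 2)).image (fun k => k + 3) := by
      ext i
      simp only [Finset.mem_Icc, Finset.mem_image, Finset.mem_range]
      constructor
      · intro hi; exact ⟨i - 3, by omega, by omega⟩
      · rintro ⟨k, hk, rfl⟩; omega
    rw [h3, Finset.sum_image (by intro a _ b _ hab; simpa using hab)]
    refine Finset.sum_congr rfl fun k hk => ?_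
    rw [Finset.mem_range] at hk
    rw [hrun, if_pos (by omega), one_mul]
    rfl
  · intro k hk
    rw [Finset.mem_range] at hk
    rw [hrun, if_neg (by omega), zero_mul]

lemma main_int {Ω : Type*} [MeasurableSpace Ω] {μ : Measure Ω} [IsProbabilityMeasure μ]
    {p q : ℝ} (X : ℕ → Ω → ℤ) (hmeas : ∀ i, Measurable (X i)) (hindep : iIndepFun X μ)
    (hup : ∀ i, μ.real {ω | X i ω = 1} = q) (hdown : ∀ i, μ.real {ω | X i ω = -1} = p)
    (hX : ∀ᵐ ω ∂μ, ∀ i, X i ω = 1 ∨ X i ω = -1)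
    (hq : 0 < q) (hqp : q < p) (hsum : p + q = 1)
    (N : ℕ) :
    ∫ ω in {ω | X 1 ω = 1 ∧ X 2 ω = 1}, (∑ i ∈ Finset.Icc 3 (cycleTau X ω),
        if walkS X i ω < walkS X (i - 1) ω ∧ walkS X i ω < N then (1 : ℝ) else 0) ∂μ
      = cfun p q N 0 * μ.real {ω | X 1 ω = 1 ∧ X 2 ω = 1} := by
  have hA : MeasurableSet {ω | X 1 ω = 1 ∧ X 2 ω = 1} :=
    (hmeas 1 (measurableSet_singleton 1)).inter (hmeas 2 (measurableSet_singleton 1))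
  have hs := total_hasSum X hmeas hindep hup hdown hX hq hqp hsum N
  have hint : ∀ k : ℕ, Integrable (fun ω => runInd X (k + 2) ω * dfun X N (k + 2) ω) μ :=
    fun k => int_Y X hmeas (k + 2) (by omega) _ (meas_dfun X hmeas N _) 1 (dfun_abs X N _)
  have hn : ∀ k ω, ‖runInd X (k + 2) ω * dfun X N (k + 2) ω‖
      = runInd X (k + 2) ω * dfun X N (k + 2) ω := fun k ω =>
    Real.norm_of_nonneg (mul_nonneg (runInd_nonneg X _ ω) (dfun_nonneg X _ _ ω))
  have h2 := hasSum_integral_of_summable_integral_norm hint (by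
    simp only [hn]; exact hs.summable)
  rw [hs.unique h2, ← integral_indicator hA]
  refine integral_congr_ae ?_
  filter_upwards [run_ae X hmeas hindep hup hdown hX hq hqp hsum] with ω h
  by_cases hω : X 1 ω = 1 ∧ X 2 ω = 1
  · rw [Set.indicator_of_mem (by exact hω), pointwise X N ω hω h]
  · rw [Set.indicator_of_notMem (by exact hω)]
    have : ∀ k, runInd X (k + 2) ω = 0 := by
      intro k
      unfold runInd; rw [if_neg]; exact fun hc => hω ⟨hc.1, hc.2.1⟩
    simp [this]


theorem stmt11 {Ω : Type*} [MeasureSpace Ω] [IsProbabilityMeasure (ℙ : Measure Ω)]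
    (q p : ℝ) (hq : 0 < q) (hq1 : q < 1 / 2) (hp : p = 1 - q)
    (X : ℕ → Ω → ℤ) (hmeas : ∀ i, Measurable (X i))
    (hindep : iIndepFun X ℙ)
    (hup : ∀ i, ℙ {ω | X i ω = 1} = ENNReal.ofReal q)
    (hdown : ∀ i, ℙ {ω | X i ω = -1} = ENNReal.ofReal p)
    (n₁ : ℕ) (hn₁ : 2 ≤ n₁) :
    ∫ ω, (∑ i ∈ Finset.Icc 3 (cycleTau X ω),
        if walkS X i ω < walkS X (i - 1) ω ∧ walkS X i ω < n₁ then (1 : ℝ) else 0)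
        ∂((ℙ : Measure Ω)[|{ω | X 1 ω = 1 ∧ X 2 ω = 1}])
      = p / (p - q) * (1 - (q / p) ^ (n₁ - 1)) := by
  have hqp : q < p := by linarith
  have hsum : p + q = 1 := by linarith
  have hup' : ∀ i, (ℙ : Measure Ω).real {ω | X i ω = 1} = q := fun i => by
    rw [measureReal_def, hup, ENNReal.toReal_ofReal hq.le]
  have hdown' : ∀ i, (ℙ : Measure Ω).real {ω | X i ω = -1} = p := fun i => by
    rw [measureReal_def, hdown, ENNReal.toReal_ofReal (by linarith)]
  have m1 : ∀ i s, MeasurableSet {ω | X i ω = s} := fun i s => hmeas i (measurableSet_singleton s)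
  have hX : ∀ᵐ ω ∂(ℙ : Measure Ω), ∀ i, X i ω = 1 ∨ X i ω = -1 := by
    rw [ae_all_iff]
    intro i
    have hd : Disjoint {ω | X i ω = 1} {ω | X i ω = -1} := by
      rw [Set.disjoint_left]
      intro ω h1 h2
      simp only [Set.mem_ofPred_eq] at h1 h2
      omega
    have hu : (ℙ : Measure Ω) ({ω | X i ω = 1} ∪ {ω | X i ω = -1}) = 1 := by
      rw [measure_union hd (m1 i _), hup, hdown, ← ENNReal.ofReal_add hq.le (by linarith)]
      rw [add_comm, hsum, ENNReal.ofReal_one]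
    have := (prob_compl_eq_zero_iff ((m1 i 1).union (m1 i (-1)))).2 hu
    rw [ae_iff]
    exact this
  have hA : (ℙ : Measure Ω).real {ω | X 1 ω = 1 ∧ X 2 ω = 1} = q * q := by
    have h12 : IndepFun (X 1) (X 2) (ℙ : Measure Ω) := hindep.indepFun (by norm_num)
    have := h12.measure_inter_preimage_eq_mul {1} {1} (measurableSet_singleton _)
      (measurableSet_singleton _)
    have e : {ω | X 1 ω = 1 ∧ X 2 ω = 1} = X 1 ⁻¹' {1} ∩ X 2 ⁻¹' {1} := rfl
    rw [measureReal_def, e, this, ENNReal.toReal_mul]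
    congr 1
    · exact hup' 1
    · exact hup' 2
  have key := main_int X hmeas hindep hup' hdown' hX hq hqp hsum n₁
  rw [ProbabilityTheory.cond, integral_smul_measure, key, hA, ENNReal.toReal_inv,
    ← measureReal_def, hA, smul_eq_mul]
  unfold cfun
  rw [if_pos (by omega)]
  field_simp
end

section
/- Assume 0 < q < 1/2 and let n₁ ≥ 2 be an integer. Conditionally on X_1 = X_2 = +1, E[ Σ_{i=3}^{τ} (S_i + 1) · 1_{(S_i < S_{i−1}) ∧ (S_i < n₁)} ] = (p/(p − q)²) ( 2p − q − (p + n₁(p − q)) (q/p)^{n₁ − 1} ). (This is the conditional expectation of D(ω), the sum over potential uncle positions of the relative height plus one, i.e., of the uncle–nephew distances.) -/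
open MeasureTheory ProbabilityTheory Filter Finset

open scoped ENNReal

set_option linter.unusedSectionVars false

namespace SM

/-- partial sums of a deterministic sequence -/
def W (x : ℕ → ℤ) (n : ℕ) : ℤ := ∑ i ∈ Finset.Icc 1 n, x i

lemma W_succ (x : ℕ → ℤ) (n : ℕ) : W x (n + 1) = W x n + x (n + 1) := by
  unfold W
  rw [Finset.sum_Icc_succ_top (by omega)]

/-- the cycle starts with two attacker blocks and is not finished at time `n` -/
def Alive (x : ℕ → ℤ) (n : ℕ) : Prop :=
  (x 1 = 1 ∧ x 2 = 1) ∧ ∀ k, 3 ≤ k → k ≤ n → 2 ≤ W x k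

lemma alive_two (x : ℕ → ℤ) : Alive x 2 ↔ (x 1 = 1 ∧ x 2 = 1) := by
  unfold Alive
  constructor
  · exact fun h => h.1
  · exact fun h => ⟨h, fun k h1 h2 => by omega⟩

lemma W_two (x : ℕ → ℤ) (h : Alive x 2) : W x 2 = 2 := by
  obtain ⟨⟨h1, h2⟩, -⟩ := h
  have : W x 2 = x 1 + x 2 := by
    rw [show (2 : ℕ) = 1 + 1 from rfl, W_succ, show (1 : ℕ) = 0 + 1 from rfl, W_succ]
    simp [W]
  rw [this, h1, h2]; rfl

lemma Alive.mono {x : ℕ → ℤ} {n m : ℕ} (h : Alive x n) (hm : m ≤ n) : Alive x m :=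
  ⟨h.1, fun k h3 hk => h.2 k h3 (hk.trans hm)⟩

lemma Alive.two_le {x : ℕ → ℤ} {n : ℕ} (h : Alive x n) (hn : 2 ≤ n) : 2 ≤ W x n := by
  rcases hn.eq_or_lt with rfl | h3
  · exact (W_two x h).ge
  · exact h.2 n h3 le_rfl

lemma alive_succ (x : ℕ → ℤ) {n : ℕ} (hn : 2 ≤ n) :
    Alive x (n + 1) ↔ Alive x n ∧ 2 ≤ W x (n + 1) := by
  constructor
  · intro h
    exact ⟨h.mono (by omega), h.two_le (by omega)⟩
  · rintro ⟨h, h2⟩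
    refine ⟨h.1, fun k h3 hk => ?_⟩
    rcases Nat.lt_or_ge k (n + 1) with hlt | hge
    · exact h.2 k h3 (by omega)
    · obtain rfl : k = n + 1 := by omega
      exact h2

lemma W_congr {x y : ℕ → ℤ} {n : ℕ} (h : ∀ i ∈ Finset.Icc 1 n, x i = y i) {k : ℕ} (hk : k ≤ n) :
    W x k = W y k := by
  unfold W
  refine Finset.sum_congr rfl fun i hi => h i ?_
  simp only [Finset.mem_Icc] at hi ⊢
  omega

lemma alive_congr {x y : ℕ → ℤ} {n : ℕ} (hn : 2 ≤ n) (h : ∀ i ∈ Finset.Icc 1 n, x i = y i) :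
    Alive x n ↔ Alive y n := by
  unfold Alive
  rw [h 1 (by simp; omega), h 2 (by simp; omega)]
  refine and_congr_right fun _ => forall_congr' fun k => forall_congr' fun _ =>
    forall_congr' fun hk => ?_
  rw [W_congr h hk]

lemma exists_hit {x : ℕ → ℤ} (hx : ∀ i, x i = 1 ∨ x i = -1) (h2 : Alive x 2) (m : ℕ)
    (h : ¬ Alive x (m + 2)) : ∃ k, 3 ≤ k ∧ k ≤ m + 2 ∧ W x k = 1 := by
  induction m with
  | zero => exact absurd h2 h
  | succ m ih =>
    by_cases hm : Alive x (m + 2)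
    · refine ⟨m + 3, by omega, by omega, ?_⟩
      have h1 := hm.two_le (by omega)
      have h3 : ¬ 2 ≤ W x (m + 2 + 1) := fun hh => h ((alive_succ x (by omega)).2 ⟨hm, hh⟩)
      have h4 := W_succ x (m + 2)
      have h5 := hx (m + 2 + 1)
      show W x (m + 2 + 1) = 1
      omega
    · obtain ⟨k, a, b, c⟩ := ih hm
      exact ⟨k, a, by omega, c⟩

lemma alive_iff_tau {x : ℕ → ℤ} (hx : ∀ i, x i = 1 ∨ x i = -1) (h2 : Alive x 2)
    (hne : {n : ℕ | 3 ≤ n ∧ W x n = 1}.Nonempty) (m : ℕ) :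
    Alive x (m + 2) ↔ m + 3 ≤ sInf {n : ℕ | 3 ≤ n ∧ W x n = 1} := by
  constructor
  · intro h
    by_contra hc
    have hmem := Nat.sInf_mem hne
    have := h.2 _ hmem.1 (by omega)
    have := hmem.2
    omega
  · intro h
    by_contra hc
    obtain ⟨k, a, b, c⟩ := exists_hit hx h2 m hc
    have := Nat.sInf_le (s := {n : ℕ | 3 ≤ n ∧ W x n = 1}) ⟨a, c⟩
    omega

/-- backward increments of the value function -/
noncomputable def e (t : ℝ) (n : ℕ) : ℕ → ℝ
  | 0 => 0
  | j + 1 => t * e t n j + ((n : ℝ) - j)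

lemma e_nonneg {t : ℝ} (ht : 0 ≤ t) (n : ℕ) {j : ℕ} (hj : j ≤ n) : 0 ≤ e t n j := by
  induction j with
  | zero => simp [e]
  | succ j ih =>
    have h1 := ih (by omega)
    have h2 : ((j + 1 : ℕ) : ℝ) ≤ n := by exact_mod_cast hj
    push_cast at h2
    simp only [e]
    have := mul_nonneg ht h1
    linarith

lemma e_closed {t : ℝ} (ht : t < 1) (n j : ℕ) :
    e t n j = (n - j) / (1 - t) + 1 / (1 - t) ^ 2 - t ^ j * (n / (1 - t) + 1 / (1 - t) ^ 2) := by
  have h : (1 - t) ≠ 0 := by linarith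
  induction j with
  | zero => simp [e]
  | succ j ih =>
    simp only [e, ih]
    push_cast
    field_simp
    ring

/-- value function -/
noncomputable def g (t : ℝ) (n : ℕ) (m : ℕ) : ℝ := ∑ k ∈ Finset.Ico 1 m, e t n (n - k)

lemma g_nonneg {t : ℝ} (ht : 0 ≤ t) (n m : ℕ) : 0 ≤ g t n m :=
  Finset.sum_nonneg fun k _ => e_nonneg ht n (by omega)

lemma g_le {t : ℝ} (ht : 0 ≤ t) (n m : ℕ) : g t n m ≤ g t n n := by
  unfold g
  rcases le_total m n with h | h
  · exact Finset.sum_le_sum_of_subset_of_nonneg (Finset.Ico_subset_Ico_right h)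
      fun k _ _ => e_nonneg ht n (by omega)
  · refine le_of_eq (Finset.sum_subset (Finset.Ico_subset_Ico_right h) fun k _ h2 => ?_).symm
    simp only [Finset.mem_Ico] at *
    rw [show n - k = 0 by omega]; rfl

lemma g_rec {p q : ℝ} (hp : 0 < p) (hpq : p + q = 1) (n m : ℕ) :
    g (q / p) n (m + 2) = q * g (q / p) n (m + 3) + p * g (q / p) n (m + 1)
      + p * (if m + 2 ≤ n then ((m : ℝ) + 2) else 0) := by
  have h1 : g (q / p) n (m + 2) = g (q / p) n (m + 1) + e (q / p) n (n - (m + 1)) := by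
    unfold g; rw [Finset.sum_Ico_succ_top (by omega)]
  have h2 : g (q / p) n (m + 3) = g (q / p) n (m + 2) + e (q / p) n (n - (m + 2)) := by
    unfold g; rw [Finset.sum_Ico_succ_top (by omega)]
  have h3 : p * e (q / p) n (n - (m + 1)) = q * e (q / p) n (n - (m + 2))
      + p * (if m + 2 ≤ n then ((m : ℝ) + 2) else 0) := by
    split_ifs with h
    · obtain ⟨d, rfl⟩ := Nat.exists_eq_add_of_le h
      rw [show m + 2 + d - (m + 1) = d + 1 by omega, show m + 2 + d - (m + 2) = d by omega]
      simp only [e]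
      push_cast
      field_simp
      ring
    · rw [show n - (m + 1) = 0 by omega, show n - (m + 2) = 0 by omega]
      simp [e]
  rw [h2, h1]
  have : q = 1 - p := by linarith
  subst this
  linear_combination h3

/-- ENNReal valued value function on ℤ -/
noncomputable def G (t : ℝ) (n : ℕ) (s : ℤ) : ℝ≥0∞ := ENNReal.ofReal (g t n s.toNat)

/-- reward -/
noncomputable def R (n : ℕ) (s x : ℤ) : ℝ≥0∞ :=
  if s + x < s ∧ s + x < n then ENNReal.ofReal ((s + x : ℤ) + 1 : ℝ) else 0

lemma G_rec {p q : ℝ} (hp : 0 < p) (hq : 0 < q) (hpq : p + q = 1) (n : ℕ) {s : ℤ} (hs : 2 ≤ s) :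
    G (q / p) n s = (ENNReal.ofReal q * G (q / p) n (s + 1) +
        ENNReal.ofReal p * G (q / p) n (s + -1)) +
      (ENNReal.ofReal q * R n s 1 + ENNReal.ofReal p * R n s (-1)) := by
  obtain ⟨m, rfl⟩ : ∃ m : ℕ, s = m + 2 := ⟨(s - 2).toNat, by omega⟩
  have ht : 0 ≤ q / p := by positivity
  have hR1 : R n ((m : ℤ) + 2) 1 = 0 := by
    unfold R; rw [if_neg]; omega
  have hR2 : R n ((m : ℤ) + 2) (-1) = ENNReal.ofReal (if m + 2 ≤ n then ((m : ℝ) + 2) else 0) := by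
    unfold R
    split_ifs with h1 h2 h2
    · congr 1; push_cast; ring
    · omega
    · omega
    · simp
  rw [hR1, hR2]
  unfold G
  rw [show ((m : ℤ) + 2).toNat = m + 2 by omega, show ((m : ℤ) + 2 + 1).toNat = m + 3 by omega,
    show ((m : ℤ) + 2 + -1).toNat = m + 1 by omega, g_rec hp hpq]
  have a := g_nonneg ht n (m + 3)
  have b := g_nonneg ht n (m + 1)
  have c : 0 ≤ (if m + 2 ≤ n then ((m : ℝ) + 2) else 0) := by split_ifs <;> positivity
  rw [mul_zero, zero_add, ← ENNReal.ofReal_mul hq.le, ← ENNReal.ofReal_mul hp.le,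
    ← ENNReal.ofReal_mul hp.le, ← ENNReal.ofReal_add (by positivity) (by positivity),
    ← ENNReal.ofReal_add (by positivity) (by positivity)]

section prob
variable {Ω : Type*} [MeasureSpace Ω] [IsProbabilityMeasure (ℙ : Measure Ω)]

lemma indep_aux (X : ℕ → Ω → ℤ) (hmeas : ∀ i, Measurable (X i)) (hindep : iIndepFun X ℙ)
    (n : ℕ) (H : (ℕ → ℤ) → ℝ≥0∞)
    (hH : ∀ x y : ℕ → ℤ, (∀ i ∈ Finset.Icc 1 n, x i = y i) → H x = H y) (c : ℤ → ℝ≥0∞) :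
    Measurable (fun ω => H (fun i => X i ω)) ∧
    ∫⁻ ω, H (fun i => X i ω) * c (X (n + 1) ω) =
      (∫⁻ ω, H (fun i => X i ω)) * ∫⁻ ω, c (X (n + 1) ω) := by
  let ext : ((Finset.Icc 1 n : Finset ℕ) → ℤ) → ℕ → ℤ :=
    fun v i => if h : i ∈ Finset.Icc 1 n then v ⟨i, h⟩ else 0
  have hfac : (fun ω => H (fun i => X i ω)) =
      (fun v => H (ext v)) ∘ (fun ω (i : (Finset.Icc 1 n : Finset ℕ)) => X i ω) := by
    funext ω
    simp only [Function.comp]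
    apply hH
    intro i hi
    simp only [ext, dif_pos hi]
  have hm1 : Measurable (fun v : ((Finset.Icc 1 n : Finset ℕ) → ℤ) => H (ext v)) :=
    measurable_of_countable _
  have hm : Measurable (fun ω => H (fun i => X i ω)) := by
    rw [hfac]
    exact hm1.comp (measurable_pi_lambda _ fun i => hmeas i)
  have hc : Measurable c := measurable_of_countable _
  refine ⟨hm, ?_⟩
  have hi := hindep.indepFun_finset (Finset.Icc 1 n) {n + 1} (by simp) hmeas
  have hi2 := hi.comp hm1
    (hc.comp (measurable_pi_apply (⟨n + 1, by simp⟩ : ({n + 1} : Finset ℕ))))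
  rw [← hfac] at hi2
  exact lintegral_mul_eq_lintegral_mul_lintegral_of_indepFun hm (hc.comp (hmeas _)) hi2

open Classical in
lemma one_step (q p : ℝ) (hq : 0 < q) (hp0 : 0 < p)
    (X : ℕ → Ω → ℤ) (hmeas : ∀ i, Measurable (X i))
    (hindep : iIndepFun X ℙ)
    (hup : ∀ i, ℙ {ω | X i ω = 1} = ENNReal.ofReal q)
    (hdown : ∀ i, ℙ {ω | X i ω = -1} = ENNReal.ofReal p)
    (hpm : ∀ᵐ ω, ∀ i, X i ω = 1 ∨ X i ω = -1)
    (n : ℕ) (hn : 2 ≤ n) (F : ℤ → ℤ → ℝ≥0∞) :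
    ∫⁻ ω, (if Alive (fun i => X i ω) n then F (W (fun i => X i ω) n) (X (n + 1) ω) else 0) =
    ∫⁻ ω, (if Alive (fun i => X i ω) n then
      (ENNReal.ofReal q * F (W (fun i => X i ω) n) 1 +
        ENNReal.ofReal p * F (W (fun i => X i ω) n) (-1)) else 0) := by
  have key : ∀ (z : ℤ) (r : ℝ≥0∞), (∀ i, ℙ {ω | X i ω = z} = r) →
    Measurable (fun ω => if Alive (fun i => X i ω) n then F (W (fun i => X i ω) n) z else 0) ∧
    ∫⁻ ω, (if Alive (fun i => X i ω) n then F (W (fun i => X i ω) n) z else 0) *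
      (if X (n + 1) ω = z then 1 else 0) =
    ∫⁻ ω, (if Alive (fun i => X i ω) n then F (W (fun i => X i ω) n) z else 0) * r := by
    intro z r hr
    obtain ⟨h1, h2⟩ := indep_aux X hmeas hindep n
      (fun x => if Alive x n then F (W x n) z else 0)
      (fun x y h => by simp only [alive_congr hn h, W_congr h le_rfl])
      (fun y => if y = z then 1 else 0)
    refine ⟨h1, ?_⟩
    rw [h2, lintegral_mul_const _ h1]
    congr 1
    have hms : MeasurableSet {ω | X (n + 1) ω = z} := hmeas (n + 1) (measurableSet_singleton z)
    rw [← hr (n + 1), ← lintegral_indicator_one hms]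
    refine lintegral_congr fun ω => ?_
    simp [Set.indicator]
  obtain ⟨m1, k1⟩ := key 1 _ hup
  obtain ⟨m2, k2⟩ := key (-1) _ hdown
  have meas1 : Measurable fun ω => (if X (n + 1) ω = 1 then (1 : ℝ≥0∞) else 0) :=
    (measurable_of_countable (fun y : ℤ => if y = 1 then (1 : ℝ≥0∞) else 0)).comp (hmeas _)
  have m1' : Measurable fun ω => (if Alive (fun i => X i ω) n then F (W (fun i => X i ω) n) 1
      else 0) * (if X (n + 1) ω = 1 then (1 : ℝ≥0∞) else 0) := m1.mul meas1
  calc _ = ∫⁻ ω, ((if Alive (fun i => X i ω) n then F (W (fun i => X i ω) n) 1 else 0) *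
      (if X (n + 1) ω = 1 then 1 else 0) +
      (if Alive (fun i => X i ω) n then F (W (fun i => X i ω) n) (-1) else 0) *
      (if X (n + 1) ω = -1 then 1 else 0)) := by
        refine lintegral_congr_ae ?_
        filter_upwards [hpm] with ω hω
        rcases hω (n + 1) with h | h <;> simp [h]
    _ = _ := by
        rw [lintegral_add_left m1', k1, k2,
          ← lintegral_add_left (m1.mul_const _)]
        refine lintegral_congr fun ω => ?_
        split_ifs
        · ring
        · simp


/-- integral of `F (S_n) (X_{n+1})` over the event that the cycle is alive -/
noncomputable def I (X : ℕ → Ω → ℤ) (n : ℕ) (F : ℤ → ℤ → ℝ≥0∞) (ω : Ω) : ℝ≥0∞ :=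
  open Classical in
  if Alive (fun i => X i ω) n then F (W (fun i => X i ω) n) (X (n + 1) ω) else 0

lemma I_meas (X : ℕ → Ω → ℤ) (hmeas : ∀ i, Measurable (X i)) (n : ℕ) (F : ℤ → ℤ → ℝ≥0∞) :
    Measurable (I X n F) := by
  classical
  have hW : ∀ k, Measurable fun ω => W (fun i => X i ω) k := fun k => by
    unfold W
    exact Finset.measurable_sum _ fun i _ => hmeas i
  have hA : MeasurableSet {ω | Alive (fun i => X i ω) n} := by
    have : {ω | Alive (fun i => X i ω) n} = ({ω | X 1 ω = 1} ∩ {ω | X 2 ω = 1}) ∩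
        ⋂ k, ⋂ (_ : 3 ≤ k), ⋂ (_ : k ≤ n), {ω | 2 ≤ W (fun i => X i ω) k} := by
      ext ω
      simp [Alive]
    rw [this]
    refine ((hmeas 1 (measurableSet_singleton 1)).inter
      (hmeas 2 (measurableSet_singleton 1))).inter ?_
    refine MeasurableSet.iInter fun k => MeasurableSet.iInter fun _ => MeasurableSet.iInter fun _ =>
      ?_
    exact hW k (measurableSet_Ici (a := (2 : ℤ)))
  have hF : Measurable fun ω => F (W (fun i => X i ω) n) (X (n + 1) ω) :=
    (measurable_of_countable (fun z : ℤ × ℤ => F z.1 z.2)).comp ((hW n).prodMk (hmeas (n + 1)))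
  exact Measurable.ite hA hF measurable_const

theorem core (q p : ℝ) (hq : 0 < q) (hq1 : q < 1 / 2) (hp : p = 1 - q)
    (X : ℕ → Ω → ℤ) (hmeas : ∀ i, Measurable (X i))
    (hindep : iIndepFun X ℙ)
    (hup : ∀ i, ℙ {ω | X i ω = 1} = ENNReal.ofReal q)
    (hdown : ∀ i, ℙ {ω | X i ω = -1} = ENNReal.ofReal p)
    (hpm : ∀ᵐ ω, ∀ i, X i ω = 1 ∨ X i ω = -1)
    (n₁ : ℕ) :
    (∀ᵐ ω, ∃ m, ¬ Alive (fun i => X i ω) (m + 2)) ∧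
    ∫⁻ ω, ∑' m : ℕ, I X (m + 2) (R n₁) ω =
      G (q / p) n₁ 2 * ℙ {ω | X 1 ω = 1 ∧ X 2 ω = 1} := by
  classical
  have hp0 : 0 < p := by linarith
  have ht : 0 ≤ q / p := by positivity
  have step := one_step q p hq hp0 X hmeas hindep hup hdown hpm
  -- survival probability
  let r : ℝ := 1 / (2 * q)
  have hr1 : 1 < r := by
    rw [lt_div_iff₀ (by positivity)]; linarith
  have hr0 : 0 < r := by linarith
  let φ : ℤ → ℝ≥0∞ := fun s => ENNReal.ofReal (r ^ s)
  let lam : ℝ := 1 / 2 + 2 * p * q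
  have hlam0 : 0 ≤ lam := by positivity
  have hlam1 : lam < 1 := by
    simp only [lam]; nlinarith
  have hφ : ∀ s, ENNReal.ofReal q * φ (s + 1) + ENNReal.ofReal p * φ (s + -1)
      = ENNReal.ofReal lam * φ s := by
    intro s
    simp only [φ]
    rw [← ENNReal.ofReal_mul hq.le, ← ENNReal.ofReal_mul hp0.le, ← ENNReal.ofReal_mul hlam0,
      ← ENNReal.ofReal_add (by positivity) (by positivity), zpow_add₀ hr0.ne', zpow_add₀ hr0.ne']
    congr 1
    have h1 : q * r = 1 / 2 := by simp only [r]; field_simp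
    have h2 : r ^ (-1 : ℤ) = 2 * q := by simp [r]
    rw [h2, zpow_one]
    simp only [lam]
    linear_combination r ^ s * h1
  let v : ℕ → ℝ≥0∞ := fun m => ∫⁻ ω, I X (m + 2) (fun s _ => φ s) ω
  have hv : ∀ m, v (m + 1) ≤ ENNReal.ofReal lam * v m := by
    intro m
    have h1 : v (m + 1) ≤ ∫⁻ ω, I X (m + 2) (fun s x => φ (s + x)) ω := by
      refine lintegral_mono fun ω => ?_
      simp only [I]
      by_cases h : Alive (fun i => X i ω) (m + 2 + 1)
      · have h' : Alive (fun i => X i ω) (m + 2) := h.mono (by omega)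
        rw [show m + 1 + 2 = m + 2 + 1 by omega, if_pos h, if_pos h', W_succ]
      · rw [show m + 1 + 2 = m + 2 + 1 by omega, if_neg h]
        exact zero_le
    refine h1.trans_eq ?_
    have := step (m + 2) (by omega) (fun s x => φ (s + x))
    simp only [hφ] at this
    unfold I
    rw [this]
    simp only [v]
    rw [← lintegral_const_mul _ (I_meas X hmeas _ _)]
    refine lintegral_congr fun ω => ?_
    simp only [I]
    split_ifs <;> simp
  have hv0 : v 0 ≤ φ 2 := by
    calc v 0 ≤ ∫⁻ ω, φ 2 := by
          refine lintegral_mono fun ω => ?_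
          simp only [I]
          split_ifs with h
          · rw [W_two _ h]
          · exact zero_le
      _ = φ 2 := by simp
  have hvm : ∀ m, v m ≤ ENNReal.ofReal lam ^ m * φ 2 := by
    intro m
    induction m with
    | zero => simpa using hv0
    | succ m ih =>
      calc v (m + 1) ≤ ENNReal.ofReal lam * v m := hv m
        _ ≤ ENNReal.ofReal lam * (ENNReal.ofReal lam ^ m * φ 2) := by gcongr
        _ = _ := by ring
  let a : ℕ → ℝ≥0∞ := fun m => ∫⁻ ω, I X (m + 2) (fun _ _ => 1) ω
  have hav : ∀ m, a m ≤ v m := by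
    intro m
    refine lintegral_mono fun ω => ?_
    simp only [I]
    split_ifs with h
    · have h2 := h.two_le (by omega)
      simp only [φ]
      rw [ENNReal.one_le_ofReal]
      exact one_le_zpow₀ hr1.le (by omega)
    · exact le_rfl
  have ha : Tendsto a atTop (nhds 0) := by
    have h1 : Tendsto (fun m => ENNReal.ofReal lam ^ m * φ 2) atTop (nhds 0) := by
      have h0 := ENNReal.tendsto_pow_atTop_nhds_zero_of_lt_one
        (r := ENNReal.ofReal lam) (by rw [ENNReal.ofReal_lt_one]; exact hlam1)
      have := ENNReal.Tendsto.mul_const (b := φ 2) h0 (Or.inr (by simp [φ]))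
      simpa using this
    exact tendsto_of_tendsto_of_tendsto_of_le_of_le tendsto_const_nhds h1 (fun _ => zero_le)
      fun m => (hav m).trans (hvm m)
  refine ⟨?_, ?_⟩
  · rw [ae_iff]
    push Not
    refine le_antisymm (ge_of_tendsto' ha fun m => ?_) zero_le
    calc ℙ {ω | ∀ m, Alive (fun i => X i ω) (m + 2)}
        ≤ ℙ {ω | 1 ≤ I X (m + 2) (fun _ _ => 1) ω} := by
          refine measure_mono fun ω hω => ?_
          simp only [Set.mem_setOf_eq, I] at *
          rw [if_pos (hω m)]
      _ ≤ a m := by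
          have := mul_meas_ge_le_lintegral (μ := ℙ) (I_meas X hmeas (m + 2) (fun _ _ => 1)) 1
          simpa using this
  -- the value function
  let u : ℕ → ℝ≥0∞ := fun m => ∫⁻ ω, I X (m + 2) (fun s _ => G (q / p) n₁ s) ω
  let ρ : ℕ → ℝ≥0∞ := fun m => ∫⁻ ω, I X (m + 2) (R n₁) ω
  have hu : ∀ m, u m = u (m + 1) + ρ m := by
    intro m
    have h1 : u (m + 1) = ∫⁻ ω, I X (m + 2) (fun s x => G (q / p) n₁ (s + x)) ω := by
      refine lintegral_congr fun ω => ?_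
      simp only [I]
      rw [show m + 1 + 2 = m + 2 + 1 by omega]
      by_cases h : Alive (fun i => X i ω) (m + 2)
      · by_cases h' : Alive (fun i => X i ω) (m + 2 + 1)
        · rw [if_pos h, if_pos h', W_succ]
        · rw [if_pos h, if_neg h']
          rw [alive_succ _ (by omega), W_succ] at h'
          have : (W (fun i => X i ω) (m + 2) + X (m + 2 + 1) ω).toNat ≤ 1 := by
            by_contra hc
            exact h' ⟨h, by omega⟩
          simp only [G, g]
          rw [Finset.Ico_eq_empty_of_le this]
          simp
      · rw [if_neg h, if_neg (fun hh => h (hh.mono (by omega)))]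
    have h2 := step (m + 2) (by omega) (fun s x => G (q / p) n₁ (s + x) + R n₁ s x)
    have h3 : u (m + 1) + ρ m =
        ∫⁻ ω, I X (m + 2) (fun s x => G (q / p) n₁ (s + x) + R n₁ s x) ω := by
      rw [h1]
      simp only [ρ]
      rw [← lintegral_add_left (I_meas X hmeas _ _)]
      refine lintegral_congr fun ω => ?_
      simp only [I]
      split_ifs <;> simp
    rw [h3]
    unfold I
    rw [h2]
    refine lintegral_congr fun ω => ?_
    simp only [I]
    split_ifs with h
    · rw [G_rec hp0 hq (by linarith) n₁ (h.two_le (by omega))]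
      ring
    · rfl
  have hu0 : u 0 = G (q / p) n₁ 2 * ℙ {ω | X 1 ω = 1 ∧ X 2 ω = 1} := by
    have hA : MeasurableSet {ω | X 1 ω = 1 ∧ X 2 ω = 1} :=
      (hmeas 1 (measurableSet_singleton 1)).inter (hmeas 2 (measurableSet_singleton 1))
    rw [← lintegral_indicator_const hA]
    refine lintegral_congr fun ω => ?_
    simp only [I, Set.indicator, Set.mem_setOf_eq]
    by_cases h : Alive (fun i => X i ω) 2
    · rw [if_pos h, if_pos ((alive_two _).1 h), W_two _ h]
    · rw [if_neg h, if_neg (fun hh => h ((alive_two _).2 hh))]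
  have hua : ∀ m, u m ≤ G (q / p) n₁ n₁ * a m := by
    intro m
    simp only [a]
    rw [← lintegral_const_mul _ (I_meas X hmeas _ _)]
    refine lintegral_mono fun ω => ?_
    simp only [I]
    split_ifs
    · rw [mul_one]
      simp only [G]
      exact ENNReal.ofReal_le_ofReal ((g_le ht _ _).trans_eq (by simp))
    · simp
  have hulim : Tendsto u atTop (nhds 0) := by
    have := ENNReal.Tendsto.const_mul (a := G (q / p) n₁ n₁) ha (Or.inr (by simp [G]))
    rw [mul_zero] at this
    exact tendsto_of_tendsto_of_tendsto_of_le_of_le tendsto_const_nhds this (fun _ => zero_le) hua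
  have hsum : ∀ m, u 0 = u m + ∑ k ∈ Finset.range m, ρ k := by
    intro m
    induction m with
    | zero => simp
    | succ m ih => rw [ih, hu m, Finset.sum_range_succ]; ring
  rw [lintegral_tsum fun m => (I_meas X hmeas _ _).aemeasurable, ← hu0]
  have h1 : Tendsto (fun m => u m + ∑ k ∈ Finset.range m, ρ k) atTop
      (nhds (0 + ∑' k, ρ k)) := hulim.add ENNReal.summable.hasSum.tendsto_sum_nat
  have h2 : Tendsto (fun m => u m + ∑ k ∈ Finset.range m, ρ k) atTop (nhds (u 0)) := by
    simp only [← hsum]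
    exact tendsto_const_nhds
  have := tendsto_nhds_unique h1 h2
  rw [zero_add] at this
  exact this

end prob

/-- pathwise identification of the sum -/
lemma path_sum {Ω : Type*} (X : ℕ → Ω → ℤ) (n₁ : ℕ) (ω : Ω)
    (hx : ∀ i, X i ω = 1 ∨ X i ω = -1) (h2 : Alive (fun i => X i ω) 2)
    (hfin : ∃ m, ¬ Alive (fun i => X i ω) (m + 2)) :
    (∑ i ∈ Finset.Icc 3 (cycleTau X ω),
        if walkS X i ω < walkS X (i - 1) ω ∧ walkS X i ω < n₁ then (walkS X i ω + 1 : ℝ) else 0)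
      = (∑' m : ℕ, I X (m + 2) (R n₁) ω).toReal := by
  classical
  obtain ⟨m₀, hm₀⟩ := hfin
  obtain ⟨k, hk3, -, hk⟩ := exists_hit hx h2 m₀ hm₀
  have hal := alive_iff_tau (x := fun i => X i ω) hx h2 ⟨k, hk3, hk⟩
  have htau : cycleTau X ω = sInf {n : ℕ | 3 ≤ n ∧ W (fun i => X i ω) n = 1} := rfl
  rw [← htau] at hal
  rw [tsum_eq_sum (s := Finset.range (cycleTau X ω - 2)), ENNReal.toReal_sum]
  · rw [Finset.range_eq_Ico, Finset.sum_Ico_eq_sum_range]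
    have hI : Finset.Icc 3 (cycleTau X ω) = Finset.Ico 3 (cycleTau X ω + 1) := by
      ext i; simp
    rw [hI, Finset.sum_Ico_eq_sum_range,
      show cycleTau X ω + 1 - 3 = cycleTau X ω - 2 - 0 by omega]
    refine Finset.sum_congr rfl fun i hi => ?_
    have hi' : i < cycleTau X ω - 2 - 0 := by simpa using hi
    have hA : Alive (fun i => X i ω) (i + 2) := (hal i).2 (by omega)
    have hW2 := hA.two_le (by omega)
    have e1 : walkS X (3 + i) ω = W (fun i => X i ω) (i + 2) + X (i + 2 + 1) ω := by
      rw [show 3 + i = i + 2 + 1 by omega]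
      exact W_succ (fun i => X i ω) (i + 2)
    have e2 : walkS X (3 + i - 1) ω = W (fun i => X i ω) (i + 2) := by
      rw [show 3 + i - 1 = i + 2 by omega]
      rfl
    rw [e1, e2, zero_add]
    simp only [I]
    rw [if_pos hA]
    unfold R
    have hx' := hx (i + 2 + 1)
    split_ifs with h
    · rw [ENNReal.toReal_ofReal]
      have : (0 : ℤ) ≤ W (fun i => X i ω) (i + 2) + X (i + 2 + 1) ω := by omega
      have : (0 : ℝ) ≤ ((W (fun i => X i ω) (i + 2) + X (i + 2 + 1) ω : ℤ) : ℝ) := by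
        exact_mod_cast this
      linarith
    · simp
  · intro i _
    simp only [I, R]
    split_ifs <;> simp
  · intro i hi
    simp only [I]
    rw [if_neg]
    intro hA
    have := (hal i).1 hA
    simp at hi
    omega

end SM

theorem stmt12 {Ω : Type*} [MeasureSpace Ω] [IsProbabilityMeasure (ℙ : Measure Ω)]
    (q p : ℝ) (hq : 0 < q) (hq1 : q < 1 / 2) (hp : p = 1 - q)
    (X : ℕ → Ω → ℤ) (hmeas : ∀ i, Measurable (X i))
    (hindep : iIndepFun X ℙ)
    (hup : ∀ i, ℙ {ω | X i ω = 1} = ENNReal.ofReal q)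
    (hdown : ∀ i, ℙ {ω | X i ω = -1} = ENNReal.ofReal p)
    (n₁ : ℕ) (hn₁ : 2 ≤ n₁) :
    ∫ ω, (∑ i ∈ Finset.Icc 3 (cycleTau X ω),
        if walkS X i ω < walkS X (i - 1) ω ∧ walkS X i ω < n₁ then (walkS X i ω + 1 : ℝ) else 0)
        ∂((ℙ : Measure Ω)[|{ω | X 1 ω = 1 ∧ X 2 ω = 1}])
      = p / (p - q) ^ 2 * (2 * p - q - (p + n₁ * (p - q)) * (q / p) ^ (n₁ - 1)) := by
  classical
  have hp0 : 0 < p := by linarith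
  have hA : MeasurableSet {ω | X 1 ω = 1 ∧ X 2 ω = 1} :=
    (hmeas 1 (measurableSet_singleton 1)).inter (hmeas 2 (measurableSet_singleton 1))
  have hpm : ∀ᵐ ω, ∀ i, X i ω = 1 ∨ X i ω = -1 := by
    rw [ae_all_iff]
    intro i
    have m1 : MeasurableSet {ω | X i ω = 1} := hmeas i (measurableSet_singleton 1)
    have m2 : MeasurableSet {ω | X i ω = -1} := hmeas i (measurableSet_singleton (-1))
    have hU : (ℙ : Measure Ω) ({ω | X i ω = 1} ∪ {ω | X i ω = -1}) = 1 := by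
      rw [measure_union _ m2, hup, hdown, ← ENNReal.ofReal_add hq.le hp0.le]
      · rw [hp]; simp
      · rw [Set.disjoint_left]
        intro ω h1 h2
        simp only [Set.mem_setOf_eq] at h1 h2
        omega
    exact (mem_ae_iff_prob_eq_one (m1.union m2)).2 hU
  obtain ⟨hfin, hint⟩ := SM.core q p hq hq1 hp X hmeas hindep hup hdown hpm n₁
  have hPA : (ℙ : Measure Ω) {ω | X 1 ω = 1 ∧ X 2 ω = 1} ≠ 0 := by
    have h := hindep.indepFun (show (1 : ℕ) ≠ 2 by norm_num)
    have h2 := h.measure_inter_preimage_eq_mul {1} {1} (measurableSet_singleton 1)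
      (measurableSet_singleton 1)
    have h3 : (ℙ : Measure Ω) {ω | X 1 ω = 1 ∧ X 2 ω = 1}
        = ℙ {ω | X 1 ω = 1} * ℙ {ω | X 2 ω = 1} := h2
    rw [h3, hup, hup]
    simp [hq]
  have hTm : Measurable fun ω => ∑' m : ℕ, SM.I X (m + 2) (SM.R n₁) ω :=
    Measurable.ennreal_tsum fun m => SM.I_meas X hmeas _ _
  have hl : ∫⁻ ω, ∑' m : ℕ, SM.I X (m + 2) (SM.R n₁) ω
      ∂((ℙ : Measure Ω)[|{ω | X 1 ω = 1 ∧ X 2 ω = 1}]) = SM.G (q / p) n₁ 2 := by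
    rw [ProbabilityTheory.cond, lintegral_smul_measure, ← lintegral_indicator hA]
    have : ∫⁻ ω, ({ω | X 1 ω = 1 ∧ X 2 ω = 1} : Set Ω).indicator
        (fun ω => ∑' m : ℕ, SM.I X (m + 2) (SM.R n₁) ω) ω
        = ∫⁻ ω, ∑' m : ℕ, SM.I X (m + 2) (SM.R n₁) ω := by
      refine lintegral_congr fun ω => ?_
      rw [Set.indicator_apply_eq_self]
      intro h
      rw [ENNReal.tsum_eq_zero]
      intro m
      simp only [SM.I]
      rw [if_neg]
      exact fun hh => h hh.1
    rw [this, hint, smul_eq_mul, mul_comm, mul_assoc,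
      ENNReal.mul_inv_cancel hPA (measure_ne_top _ _), mul_one]
  have hae : (fun ω => ∑ i ∈ Finset.Icc 3 (cycleTau X ω),
        if walkS X i ω < walkS X (i - 1) ω ∧ walkS X i ω < n₁ then (walkS X i ω + 1 : ℝ) else 0)
      =ᵐ[(ℙ : Measure Ω)[|{ω | X 1 ω = 1 ∧ X 2 ω = 1}]]
      fun ω => (∑' m : ℕ, SM.I X (m + 2) (SM.R n₁) ω).toReal := by
    have hac : (ℙ : Measure Ω)[|{ω | X 1 ω = 1 ∧ X 2 ω = 1}] ≪ ℙ := cond_absolutelyContinuous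
    filter_upwards [hac.ae_le hpm, hac.ae_le hfin, ae_cond_mem hA] with ω h1 h2 h3
    exact SM.path_sum X n₁ ω h1 ((SM.alive_two _).2 h3) h2
  rw [integral_congr_ae hae, integral_toReal hTm.aemeasurable
    (ae_lt_top hTm (by rw [hl]; simp [SM.G])), hl]
  have hpq : p - q ≠ 0 := by linarith
  have ht : q / p < 1 := by rw [div_lt_one hp0]; linarith
  simp only [SM.G]
  rw [ENNReal.toReal_ofReal (SM.g_nonneg (by positivity) _ _)]
  have : SM.g (q / p) n₁ (2 : ℤ).toNat = SM.e (q / p) n₁ (n₁ - 1) := by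
    simp [SM.g]
  rw [this, SM.e_closed ht, Nat.cast_sub (by omega)]
  have h1t : 1 - q / p = (p - q) / p := by field_simp
  rw [h1t]
  generalize (q / p) ^ (n₁ - 1) = z
  push_cast
  field_simp
  ring
end
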